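/- arXiv:2410.22920 — 3 statements merged into one kernel-verified Lean document; each statement's English description precedes it below -/
import Mathlib

section
/- Local approximation of the operator V: for every K ∈ ℕ, every ε ∈ (0,1) and every J ∈ ℕ there exists a constant C > 0, depending only on K, ε, J and g, such that for all N ≥ 1, all a, b, Θ₀ ∈ ℝ with a² + b² = 1, and every f ∈ C^{K+J+2}(ℝ²) with supp f ⊂ B₁(0), setting w(x) = f(x)·sin(N(b x₁ + a x₂) + Θ₀), one has ‖V(w) − V^K(w)‖_{C^J} ≤ C ( Σ_{i=0}^{K} N^{iε + J − K} ‖f‖_{C^{K−i+J}} + N^{J − (K+2)ε} ‖f‖_{C^{K+J+1}} ). -/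
open MeasureTheory Real Filter

/-- First spatial partial derivative `∂/∂x₁`. -/
noncomputable def pd1 (f : ℝ × ℝ → ℝ) : ℝ × ℝ → ℝ := fun x => fderiv ℝ f x (1, 0)

/-- Second spatial partial derivative `∂/∂x₂`. -/
noncomputable def pd2 (f : ℝ × ℝ → ℝ) : ℝ × ℝ → ℝ := fun x => fderiv ℝ f x (0, 1)

/-- Mixed partial derivative `∂₁^i ∂₂^j f`. -/
noncomputable def pdMix (i j : ℕ) (f : ℝ × ℝ → ℝ) : ℝ × ℝ → ℝ := pd1^[i] (pd2^[j] f)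

/-- The `C^k` norm: supremum of the absolute values of all partial derivatives
of order at most `k`. -/
noncomputable def CkNorm (k : ℕ) (f : ℝ × ℝ → ℝ) : ℝ :=
  sSup {y : ℝ | ∃ i j : ℕ, ∃ x : ℝ × ℝ, i + j ≤ k ∧ y = |pdMix i j f x|}

/-- The Euclidean norm `|h|` of `h ∈ ℝ²`. -/
noncomputable def rad (h : ℝ × ℝ) : ℝ := Real.sqrt (h.1 ^ 2 + h.2 ^ 2)

/-- A smooth radial cutoff: `C^∞`, nonincreasing on `[0,∞)`, equal to `1` on `(-∞,1/2]`
and to `0` on `[1,∞)`. -/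
def IsCutoff (g : ℝ → ℝ) : Prop :=
  ContDiff ℝ (⊤ : ℕ∞) g ∧ AntitoneOn g (Set.Ici 0) ∧
    (∀ r : ℝ, r ≤ 1 / 2 → g r = 1) ∧ (∀ r : ℝ, 1 ≤ r → g r = 0)

/-- The kernel moment integral `T^{i,j,s}_N` (with `cos(a h₂ + b h₁)`). -/
noncomputable def Tijs (g : ℝ → ℝ) (ε a b : ℝ) (i j : ℕ) (N : ℝ) : ℝ :=
  ∫ h : ℝ × ℝ, (h.1 / (h.1 ^ 2 + h.2 ^ 2))
    * (h.1 ^ (i - j) * h.2 ^ j / ((Nat.factorial (i - j) : ℝ) * (Nat.factorial j : ℝ)))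
    * Real.cos (a * h.2 + b * h.1) * g (N ^ (ε - 1) * rad h)

/-- The kernel moment integral `T^{i,j,c}_N` (with `sin(a h₂ + b h₁)`). -/
noncomputable def Tijc (g : ℝ → ℝ) (ε a b : ℝ) (i j : ℕ) (N : ℝ) : ℝ :=
  ∫ h : ℝ × ℝ, (h.1 / (h.1 ^ 2 + h.2 ^ 2))
    * (h.1 ^ (i - j) * h.2 ^ j / ((Nat.factorial (i - j) : ℝ) * (Nat.factorial j : ℝ)))
    * Real.sin (a * h.2 + b * h.1) * g (N ^ (ε - 1) * rad h)

/-- The operator `V(w)(x) = ∫ (h₁/|h|²) w(x+h) dh`. -/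
noncomputable def Vop (w : ℝ × ℝ → ℝ) : ℝ × ℝ → ℝ :=
  fun x => ∫ h : ℝ × ℝ, (h.1 / (h.1 ^ 2 + h.2 ^ 2)) * w (x + h)

/-- The local approximation `V^K`, for a density with amplitude `f` and phase
`N(b x₁ + a x₂) + Θ₀`, built from the limiting constants `cs i j`, `cc i j`. -/
noncomputable def VKapprox (cs cc : ℕ → ℕ → ℝ) (K : ℕ) (N a b Θ₀ : ℝ)
    (f : ℝ × ℝ → ℝ) : ℝ × ℝ → ℝ :=
  fun x => ∑ i ∈ Finset.range (K + 1), ∑ j ∈ Finset.range (i + 1),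
    (pdMix (i - j) j f x / N ^ (i + 1)) *
      (cs i j * Real.sin (N * (b * x.1 + a * x.2) + Θ₀)
        + cc i j * Real.cos (N * (b * x.1 + a * x.2) + Θ₀))

/-! ### Directional derivatives and mixed partial derivatives -/

/-- The derivative of `u` in the direction `v`. -/
noncomputable def dirD (v : ℝ × ℝ) (u : ℝ × ℝ → ℝ) : ℝ × ℝ → ℝ := fun x => fderiv ℝ u x v

lemma pd1_eq_dirD : pd1 = dirD (1, 0) := rfl

lemma pd2_eq_dirD : pd2 = dirD (0, 1) := rfl

lemma dirD_eq (v : ℝ × ℝ) (u : ℝ × ℝ → ℝ) :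
    dirD v u = fun x => v.1 * pd1 u x + v.2 * pd2 u x := by
  funext x
  have hv : v = v.1 • ((1, 0) : ℝ × ℝ) + v.2 • ((0, 1) : ℝ × ℝ) := by
    ext <;> simp
  simp only [dirD, pd1, pd2]
  conv_lhs => rw [hv]
  simp only [map_add, map_smul, smul_eq_mul]

lemma contDiff_dirD {n : ℕ} {u : ℝ × ℝ → ℝ} (hu : ContDiff ℝ (n + 1 : ℕ) u) (v : ℝ × ℝ) :
    ContDiff ℝ n (dirD v u) :=
  (hu.fderiv_right (m := n) (by norm_cast)).clm_apply contDiff_const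

lemma dirD_comm {u : ℝ × ℝ → ℝ} (hu : ContDiff ℝ 2 u) (v w : ℝ × ℝ) :
    dirD v (dirD w u) = dirD w (dirD v u) := by
  funext x
  have hd : DifferentiableAt ℝ (fderiv ℝ u) x :=
    ((hu.fderiv_right (m := 1) (by norm_num)).differentiable (by norm_num)).differentiableAt
  have h := (hu.contDiffAt (x := x)).isSymmSndFDerivAt (by simp) v w
  have key : ∀ p q : ℝ × ℝ, dirD p (dirD q u) x = fderiv ℝ (fderiv ℝ u) x p q := by
    intro p q
    change fderiv ℝ (fun y => fderiv ℝ u y q) x p = _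
    rw [fderiv_clm_apply hd (differentiableAt_const q)]
    simp
  rw [key, key, h]

lemma dirD_add {u w : ℝ × ℝ → ℝ} (hu : Differentiable ℝ u) (hw : Differentiable ℝ w)
    (v : ℝ × ℝ) : dirD v (fun x => u x + w x) = fun x => dirD v u x + dirD v w x := by
  funext x
  simp only [dirD]
  rw [fderiv_fun_add (hu x) (hw x)]
  rfl

lemma dirD_sub {u w : ℝ × ℝ → ℝ} (hu : Differentiable ℝ u) (hw : Differentiable ℝ w)
    (v : ℝ × ℝ) : dirD v (fun x => u x - w x) = fun x => dirD v u x - dirD v w x := by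
  funext x
  simp only [dirD]
  rw [fderiv_fun_sub (hu x) (hw x)]
  rfl

lemma dirD_mul {u w : ℝ × ℝ → ℝ} (hu : Differentiable ℝ u) (hw : Differentiable ℝ w)
    (v : ℝ × ℝ) :
    dirD v (fun x => u x * w x) = fun x => dirD v u x * w x + u x * dirD v w x := by
  funext x
  simp only [dirD]
  rw [fderiv_fun_mul (hu x) (hw x)]
  simp only [add_apply, smul_apply, smul_eq_mul]
  ring

lemma dirD_const_mul (c : ℝ) (u : ℝ × ℝ → ℝ) (v : ℝ × ℝ) :
    dirD v (fun x => c * u x) = fun x => c * dirD v u x := by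
  funext x
  simp only [dirD]
  rw [show (fun x => c * u x) = c • u from rfl, fderiv_const_smul_field]
  rfl

lemma dirD_sum {ι : Type*} (s : Finset ι) {u : ι → ℝ × ℝ → ℝ}
    (hu : ∀ i ∈ s, Differentiable ℝ (u i)) (v : ℝ × ℝ) :
    dirD v (fun x => ∑ i ∈ s, u i x) = fun x => ∑ i ∈ s, dirD v (u i) x := by
  funext x
  simp only [dirD]
  rw [fderiv_fun_sum fun i hi => hu i hi x]
  simp

lemma dirD_congr_nhds {u w : ℝ × ℝ → ℝ} {x : ℝ × ℝ} (h : u =ᶠ[nhds x] w) (v : ℝ × ℝ) :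
    dirD v u =ᶠ[nhds x] dirD v w := by
  filter_upwards [h.fderiv (𝕜 := ℝ)] with y hy
  simp only [dirD, hy]

lemma dirD_iterate_congr_nhds {u w : ℝ × ℝ → ℝ} {x : ℝ × ℝ} (h : u =ᶠ[nhds x] w) (v : ℝ × ℝ)
    (n : ℕ) : (dirD v)^[n] u =ᶠ[nhds x] (dirD v)^[n] w := by
  induction n generalizing u w with
  | zero => exact h
  | succ n ih => exact ih (dirD_congr_nhds h v)

lemma dirD_iterate_const_mul (c : ℝ) (u : ℝ × ℝ → ℝ) (v : ℝ × ℝ) (n : ℕ) :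
    (dirD v)^[n] (fun x => c * u x) = fun x => c * (dirD v)^[n] u x := by
  induction n generalizing u with
  | zero => rfl
  | succ n ih => rw [Function.iterate_succ_apply, dirD_const_mul, ih, Function.iterate_succ_apply]

lemma dirD_iterate_zero (v : ℝ × ℝ) (n : ℕ) (x : ℝ × ℝ) :
    (dirD v)^[n] (fun _ => 0) x = 0 := by
  have := congrFun (dirD_iterate_const_mul 0 (fun _ => 0) v n) x
  simpa using this

lemma dirD_iterate_comp_smul (c : ℝ) (u : ℝ × ℝ → ℝ) (v : ℝ × ℝ) (n : ℕ) :
    (dirD v)^[n] (fun x => u (c • x)) = fun x => c ^ n * (dirD v)^[n] u (c • x) := by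
  induction n generalizing u with
  | zero => simp
  | succ n ih =>
    have h1 : dirD v (fun x => u (c • x)) = fun x => c * dirD v u (c • x) := by
      funext x
      simp only [dirD]
      rw [fderiv_comp_smul]
      rfl
    rw [Function.iterate_succ_apply, h1, dirD_iterate_const_mul, ih, Function.iterate_succ_apply]
    funext x
    ring

lemma dirD_iterate_comp_const_add (c : ℝ × ℝ) (u : ℝ × ℝ → ℝ) (v : ℝ × ℝ) (n : ℕ) :
    (dirD v)^[n] (fun x => u (c + x)) = fun x => (dirD v)^[n] u (c + x) := by
  induction n generalizing u with
  | zero => simp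
  | succ n ih =>
    have h1 : dirD v (fun x => u (c + x)) = fun x => dirD v u (c + x) := by
      funext x
      simp only [dirD]
      rw [fderiv_comp_add_left]
    rw [Function.iterate_succ_apply, h1, ih, Function.iterate_succ_apply]

lemma contDiff_dirD_iterate {n m : ℕ} {u : ℝ × ℝ → ℝ} (hu : ContDiff ℝ (n + m : ℕ) u)
    (v : ℝ × ℝ) : ContDiff ℝ n ((dirD v)^[m] u) := by
  induction m generalizing u with
  | zero => simpa using hu
  | succ m ih => exact ih (contDiff_dirD hu v)

lemma contDiff_pdMix {n i j : ℕ} {u : ℝ × ℝ → ℝ} (hu : ContDiff ℝ (n + i + j : ℕ) u) :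
    ContDiff ℝ n (pdMix i j u) :=
  contDiff_dirD_iterate (contDiff_dirD_iterate hu _) _

lemma dirD_iterate_comm {n : ℕ} {u : ℝ × ℝ → ℝ} (hu : ContDiff ℝ (n + 1 : ℕ) u)
    (v w : ℝ × ℝ) : (dirD v)^[n] (dirD w u) = dirD w ((dirD v)^[n] u) := by
  induction n generalizing u with
  | zero => rfl
  | succ n ih =>
    rw [Function.iterate_succ_apply, Function.iterate_succ_apply, ← ih (contDiff_dirD hu v),
      dirD_comm (hu.of_le (by norm_cast; omega))]

lemma pdMix_dirD {i j : ℕ} {u : ℝ × ℝ → ℝ} (hu : ContDiff ℝ (i + j + 1 : ℕ) u) (v : ℝ × ℝ) :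
    pdMix i j (dirD v u) = dirD v (pdMix i j u) := by
  simp only [pdMix, pd1_eq_dirD, pd2_eq_dirD]
  rw [dirD_iterate_comm (hu.of_le (by norm_cast; omega)),
    dirD_iterate_comm (contDiff_dirD_iterate (hu.of_le (by norm_cast; omega)) _)]

lemma pdMix_pd1 {i j : ℕ} {u : ℝ × ℝ → ℝ} (hu : ContDiff ℝ (i + j + 1 : ℕ) u) :
    pdMix i j (pd1 u) = pdMix (i + 1) j u := by
  rw [pd1_eq_dirD, pdMix_dirD hu]
  simp only [pdMix, Function.iterate_succ_apply', pd1_eq_dirD]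

lemma pdMix_pd2 {i j : ℕ} {u : ℝ × ℝ → ℝ} : pdMix i j (pd2 u) = pdMix i (j + 1) u := rfl

lemma dirD_iterate_add {n : ℕ} {u w : ℝ × ℝ → ℝ} (hu : ContDiff ℝ n u) (hw : ContDiff ℝ n w)
    (v : ℝ × ℝ) :
    (dirD v)^[n] (fun x => u x + w x) = fun x => (dirD v)^[n] u x + (dirD v)^[n] w x := by
  induction n generalizing u w with
  | zero => rfl
  | succ n ih =>
    rw [Function.iterate_succ_apply, dirD_add (hu.differentiable (by simp))
      (hw.differentiable (by simp)), ih (contDiff_dirD hu v) (contDiff_dirD hw v)]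
    rfl

lemma pdMix_add {i j : ℕ} {u w : ℝ × ℝ → ℝ} (hu : ContDiff ℝ (i + j : ℕ) u)
    (hw : ContDiff ℝ (i + j : ℕ) w) :
    pdMix i j (fun x => u x + w x) = fun x => pdMix i j u x + pdMix i j w x := by
  simp only [pdMix, pd1_eq_dirD, pd2_eq_dirD]
  rw [dirD_iterate_add (hu.of_le (by norm_cast; omega)) (hw.of_le (by norm_cast; omega)),
    dirD_iterate_add (contDiff_dirD_iterate hu _) (contDiff_dirD_iterate hw _)]

lemma pdMix_const_mul (i j : ℕ) (c : ℝ) (u : ℝ × ℝ → ℝ) :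
    pdMix i j (fun x => c * u x) = fun x => c * pdMix i j u x := by
  simp only [pdMix, pd1_eq_dirD, pd2_eq_dirD]
  rw [dirD_iterate_const_mul, dirD_iterate_const_mul]

/-- Binomial expansion of iterated directional derivatives. -/
lemma dirD_iterate_eq_sum {n : ℕ} {u : ℝ × ℝ → ℝ} (hu : ContDiff ℝ n u) (v x : ℝ × ℝ) :
    (dirD v)^[n] u x = ∑ p ∈ Finset.HasAntidiagonal.antidiagonal n,
      (n.choose p.1 : ℝ) * (v.1 ^ p.1 * v.2 ^ p.2 * pdMix p.1 p.2 u x) := by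
  induction n generalizing u with
  | zero => simp [pdMix]
  | succ n ih =>
    have h1 : ContDiff ℝ n (fun x => v.1 * pd1 u x) := contDiff_const.mul (contDiff_dirD hu _)
    have h2 : ContDiff ℝ n (fun x => v.2 * pd2 u x) := contDiff_const.mul (contDiff_dirD hu _)
    rw [Function.iterate_succ_apply, dirD_eq, dirD_iterate_add h1 h2, dirD_iterate_const_mul,
      dirD_iterate_const_mul,
      Finset.sum_antidiagonal_choose_succ_mul
        (fun i j => v.1 ^ i * v.2 ^ j * pdMix i j u x) n]
    simp only []
    rw [ih (u := pd1 u) (contDiff_dirD hu _),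
      ih (u := pd2 u) (contDiff_dirD hu _), add_comm, Finset.mul_sum, Finset.mul_sum]
    congr 1
    · refine Finset.sum_congr rfl fun p _ => ?_
      rw [pdMix_pd2]
      ring
    · refine Finset.sum_congr rfl fun p hp => ?_
      rw [Finset.HasAntidiagonal.mem_antidiagonal] at hp
      rw [pdMix_pd1 (by rw [hp]; exact hu), Nat.choose_symm_of_eq_add hp.symm]
      ring

lemma iteratedDeriv_line {n : ℕ} {u : ℝ × ℝ → ℝ} (hu : ContDiff ℝ n u) (x v : ℝ × ℝ) :
    iteratedDeriv n (fun t : ℝ => u (x + t • v)) = fun t => (dirD v)^[n] u (x + t • v) := by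
  induction n generalizing u with
  | zero => simp
  | succ n ih =>
    have h : deriv (fun t : ℝ => u (x + t • v)) = fun t => dirD v u (x + t • v) := by
      funext t
      have hl : HasDerivAt (fun t : ℝ => x + t • v) v t := by
        simpa using ((hasDerivAt_id t).smul_const v).const_add x
      exact ((hu.differentiable (by simp) _).hasFDerivAt.comp_hasDerivAt t hl).deriv
    rw [iteratedDeriv_succ', h, ih (contDiff_dirD hu v)]
    rfl

/-- Leibniz rule for iterated directional derivatives. -/
lemma dirD_iterate_mul {n : ℕ} {u w : ℝ × ℝ → ℝ} (hu : ContDiff ℝ n u) (hw : ContDiff ℝ n w)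
    (v x : ℝ × ℝ) :
    (dirD v)^[n] (fun y => u y * w y) x = ∑ l ∈ Finset.range (n + 1),
      n.choose l * (dirD v)^[l] u x * (dirD v)^[n - l] w x := by
  have hl : ContDiff ℝ n (fun t : ℝ => x + t • v) := by fun_prop
  have key := iteratedDeriv_fun_mul (x := (0 : ℝ)) (hu.comp hl).contDiffAt
    (hw.comp hl).contDiffAt
  have e1 := congrFun (iteratedDeriv_line (hu.mul hw) x v) 0
  simp only [Function.comp_def] at key
  rw [key] at e1
  simp only [zero_smul, add_zero] at e1
  rw [← e1]
  refine Finset.sum_congr rfl fun l hln => ?_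
  rw [Finset.mem_range] at hln
  rw [iteratedDeriv_line (hu.of_le (by norm_cast; omega)),
    iteratedDeriv_line (hw.of_le (by norm_cast; omega))]
  simp

lemma abs_fst_le_rad (h : ℝ × ℝ) : |h.1| ≤ rad h :=
  Real.abs_le_sqrt (by nlinarith [sq_nonneg h.2])

lemma abs_snd_le_rad (h : ℝ × ℝ) : |h.2| ≤ rad h :=
  Real.abs_le_sqrt (by nlinarith [sq_nonneg h.1])

lemma rad_nonneg (h : ℝ × ℝ) : 0 ≤ rad h := Real.sqrt_nonneg _

lemma rad_sq (h : ℝ × ℝ) : rad h ^ 2 = h.1 ^ 2 + h.2 ^ 2 := Real.sq_sqrt (by positivity)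

lemma abs_dirD_iterate_le {n : ℕ} {u : ℝ × ℝ → ℝ} (hu : ContDiff ℝ n u) (v x : ℝ × ℝ) {M : ℝ}
    (hM : ∀ i j : ℕ, i + j = n → |pdMix i j u x| ≤ M) :
    |(dirD v)^[n] u x| ≤ 2 ^ n * rad v ^ n * M := by
  rw [dirD_iterate_eq_sum hu]
  have hsum : ∑ p ∈ Finset.HasAntidiagonal.antidiagonal n, (n.choose p.1 : ℝ) = 2 ^ n := by
    have := Nat.sum_range_choose n
    rw [Finset.Nat.sum_antidiagonal_eq_sum_range_succ_mk]
    exact_mod_cast this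
  calc _ ≤ ∑ p ∈ Finset.HasAntidiagonal.antidiagonal n,
        |(n.choose p.1 : ℝ) * (v.1 ^ p.1 * v.2 ^ p.2 * pdMix p.1 p.2 u x)| :=
        Finset.abs_sum_le_sum_abs _ _
    _ ≤ ∑ p ∈ Finset.HasAntidiagonal.antidiagonal n, (n.choose p.1 : ℝ) * (rad v ^ n * M) := by
        refine Finset.sum_le_sum fun p hp => ?_
        rw [Finset.HasAntidiagonal.mem_antidiagonal] at hp
        rw [abs_mul, abs_mul, abs_mul, abs_pow, abs_pow, Nat.abs_cast, ← hp, pow_add]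
        have := rad_nonneg v
        gcongr
        · exact abs_fst_le_rad v
        · exact abs_snd_le_rad v
        · exact hM _ _ hp
    _ = _ := by rw [← Finset.sum_mul, hsum]; ring

/-! ### Functions supported in the closed unit ball and their `C^k` norms -/

/-- `f` vanishes outside the closed Euclidean unit ball. -/
def SuppBall (f : ℝ × ℝ → ℝ) : Prop := ∀ x : ℝ × ℝ, f x ≠ 0 → x.1 ^ 2 + x.2 ^ 2 ≤ 1

lemma isClosed_sq_le (c : ℝ) : IsClosed {x : ℝ × ℝ | x.1 ^ 2 + x.2 ^ 2 ≤ c} :=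
  isClosed_le (by fun_prop) continuous_const

lemma isCompact_sq_le (c : ℝ) : IsCompact {x : ℝ × ℝ | x.1 ^ 2 + x.2 ^ 2 ≤ c} := by
  refine (isCompact_Icc (a := ((-√c, -√c) : ℝ × ℝ)) (b := (√c, √c))).of_isClosed_subset
    (isClosed_sq_le c) fun x hx => ?_
  simp only [Set.mem_ofPred_eq] at hx
  have h1 := abs_le.mp (Real.abs_le_sqrt (x := x.1) (y := c) (by nlinarith [sq_nonneg x.2]))
  have h2 := abs_le.mp (Real.abs_le_sqrt (x := x.2) (y := c) (by nlinarith [sq_nonneg x.1]))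
  exact ⟨⟨h1.1, h2.1⟩, ⟨h1.2, h2.2⟩⟩

lemma SuppBall.hasCompactSupport {f : ℝ × ℝ → ℝ} (hf : SuppBall f) : HasCompactSupport f := by
  refine HasCompactSupport.intro (isCompact_sq_le 1) fun x hx => ?_
  by_contra h
  exact hx (hf x h)

lemma SuppBall.dirD {f : ℝ × ℝ → ℝ} (hf : SuppBall f) (v : ℝ × ℝ) : SuppBall (dirD v f) := by
  intro x hx
  have h1 : x ∈ Function.support (fderiv ℝ f) := by
    intro h
    exact hx (by simp [_root_.dirD, h])
  have h2 : tsupport f ⊆ {x : ℝ × ℝ | x.1 ^ 2 + x.2 ^ 2 ≤ 1} :=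
    closure_minimal (fun y hy => hf y hy) (isClosed_sq_le 1)
  exact h2 (support_fderiv_subset ℝ h1)

lemma SuppBall.dirD_iterate {f : ℝ × ℝ → ℝ} (hf : SuppBall f) (v : ℝ × ℝ) (n : ℕ) :
    SuppBall ((_root_.dirD v)^[n] f) := by
  induction n generalizing f with
  | zero => exact hf
  | succ n ih => exact ih (hf.dirD v)

lemma SuppBall.pdMix {f : ℝ × ℝ → ℝ} (hf : SuppBall f) (i j : ℕ) : SuppBall (pdMix i j f) :=
  (hf.dirD_iterate (0, 1) j).dirD_iterate (1, 0) i

lemma SuppBall.mul_right {f : ℝ × ℝ → ℝ} (hf : SuppBall f) (w : ℝ × ℝ → ℝ) :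
    SuppBall (fun x => f x * w x) := fun x hx => hf x (left_ne_zero_of_mul hx)

lemma bddAbove_CkNorm {k : ℕ} {f : ℝ × ℝ → ℝ} (hf : ContDiff ℝ k f) (hs : SuppBall f) :
    BddAbove {y : ℝ | ∃ i j : ℕ, ∃ x : ℝ × ℝ, i + j ≤ k ∧ y = |pdMix i j f x|} := by
  have h : ∀ p : ℕ × ℕ, ∃ M : ℝ, p.1 + p.2 ≤ k → ∀ x, |pdMix p.1 p.2 f x| ≤ M := by
    intro p
    by_cases hp : p.1 + p.2 ≤ k
    · have hc : Continuous (pdMix p.1 p.2 f) :=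
        (contDiff_pdMix (n := 0) (hf.of_le (by norm_cast; omega))).continuous
      obtain ⟨M, hM⟩ := hc.bounded_above_of_compact_support (hs.pdMix p.1 p.2).hasCompactSupport
      exact ⟨M, fun _ x => hM x⟩
    · exact ⟨0, fun h => absurd h hp⟩
  choose M hM using h
  refine ⟨∑ p ∈ Finset.range (k + 1) ×ˢ Finset.range (k + 1), |M p|, ?_⟩
  rintro y ⟨i, j, x, hij, rfl⟩
  refine (hM (i, j) hij x).trans ((le_abs_self _).trans ?_)
  refine Finset.single_le_sum (f := fun p => |M p|) (fun _ _ => abs_nonneg _) ?_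
  simp only [Finset.mem_product, Finset.mem_range]
  omega

lemma abs_pdMix_le_CkNorm {k i j : ℕ} {f : ℝ × ℝ → ℝ} (hf : ContDiff ℝ k f) (hs : SuppBall f)
    (hij : i + j ≤ k) (x : ℝ × ℝ) : |pdMix i j f x| ≤ CkNorm k f :=
  le_csSup (bddAbove_CkNorm hf hs) ⟨i, j, x, hij, rfl⟩

lemma CkNorm_le {k : ℕ} {f : ℝ × ℝ → ℝ} {M : ℝ}
    (h : ∀ i j : ℕ, ∀ x, i + j ≤ k → |pdMix i j f x| ≤ M) : CkNorm k f ≤ M := by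
  refine csSup_le ⟨_, 0, 0, 0, Nat.zero_le _, rfl⟩ ?_
  rintro y ⟨i, j, x, hij, rfl⟩
  exact h i j x hij

lemma CkNorm_nonneg (k : ℕ) (f : ℝ × ℝ → ℝ) : 0 ≤ CkNorm k f := by
  refine Real.sSup_nonneg ?_
  rintro y ⟨i, j, x, -, rfl⟩
  exact abs_nonneg _

lemma CkNorm_mono {k l : ℕ} {f : ℝ × ℝ → ℝ} (hf : ContDiff ℝ l f) (hs : SuppBall f)
    (hkl : k ≤ l) : CkNorm k f ≤ CkNorm l f :=
  CkNorm_le fun _ _ x hij => abs_pdMix_le_CkNorm hf hs (hij.trans hkl) x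

lemma CkNorm_pd1_le {k : ℕ} {f : ℝ × ℝ → ℝ} (hf : ContDiff ℝ (k + 1 : ℕ) f) (hs : SuppBall f) :
    CkNorm k (pd1 f) ≤ CkNorm (k + 1) f :=
  CkNorm_le fun i j x hij => by
    rw [pdMix_pd1 (hf.of_le (by norm_cast; omega))]
    exact abs_pdMix_le_CkNorm hf hs (by omega) x

lemma CkNorm_pd2_le {k : ℕ} {f : ℝ × ℝ → ℝ} (hf : ContDiff ℝ (k + 1 : ℕ) f) (hs : SuppBall f) :
    CkNorm k (pd2 f) ≤ CkNorm (k + 1) f :=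
  CkNorm_le fun i j x hij => by
    rw [pdMix_pd2]
    exact abs_pdMix_le_CkNorm hf hs (by omega) x

/-- Taylor's formula with remainder controlled by the `C^{K+1}` norm. -/
lemma abs_sub_taylor_le {K : ℕ} {f : ℝ × ℝ → ℝ} (hf : ContDiff ℝ (K + 1 : ℕ) f)
    (hs : SuppBall f) (x h : ℝ × ℝ) :
    |f (x + h) - ∑ i ∈ Finset.range (K + 1), ∑ j ∈ Finset.range (i + 1),
        pdMix (i - j) j f x *
          (h.1 ^ (i - j) * h.2 ^ j / ((Nat.factorial (i - j) : ℝ) * (Nat.factorial j : ℝ)))|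
      ≤ 2 ^ (K + 1) * CkNorm (K + 1) f * rad h ^ (K + 1) := by
  have hl : ContDiff ℝ (K + 1 : ℕ) (fun t : ℝ => f (x + t • h)) :=
    hf.comp (by fun_prop)
  have hu : UniqueDiffOn ℝ (Set.Icc (0 : ℝ) 1) := uniqueDiffOn_Icc one_pos
  have hw : ∀ n ≤ K + 1, ∀ t ∈ Set.Icc (0 : ℝ) 1,
      iteratedDerivWithin n (fun t : ℝ => f (x + t • h)) (Set.Icc 0 1) t
        = (dirD h)^[n] f (x + t • h) := by
    intro n hn t ht
    rw [iteratedDerivWithin_eq_iteratedDeriv hu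
      (hl.of_le (by norm_cast)).contDiffAt ht, iteratedDeriv_line (hf.of_le (by norm_cast))]
  have hb := taylor_mean_remainder_bound (f := fun t : ℝ => f (x + t • h)) (n := K)
    (C := 2 ^ (K + 1) * rad h ^ (K + 1) * CkNorm (K + 1) f)
    zero_le_one (by exact_mod_cast hl.contDiffOn) (Set.right_mem_Icc.mpr zero_le_one)
    fun t ht => by
      rw [hw _ le_rfl t ht]
      exact abs_dirD_iterate_le hf _ _ fun i j hij => abs_pdMix_le_CkNorm hf hs hij.le _
  have ht : taylorWithinEval (fun t : ℝ => f (x + t • h)) K (Set.Icc 0 1) 0 1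
      = ∑ i ∈ Finset.range (K + 1), ∑ j ∈ Finset.range (i + 1), pdMix (i - j) j f x *
          (h.1 ^ (i - j) * h.2 ^ j /
            ((Nat.factorial (i - j) : ℝ) * (Nat.factorial j : ℝ))) := by
    rw [taylor_within_apply]
    refine Finset.sum_congr rfl fun i hi => ?_
    rw [Finset.mem_range] at hi
    rw [hw i hi.le 0 (Set.left_mem_Icc.mpr zero_le_one),
      dirD_iterate_eq_sum (hf.of_le (by norm_cast; omega)), smul_eq_mul, Finset.mul_sum,
      ← Finset.Nat.sum_antidiagonal_swap, Finset.Nat.sum_antidiagonal_eq_sum_range_succ_mk]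
    refine Finset.sum_congr rfl fun j hj => ?_
    have hj' : j ≤ i := Nat.lt_succ_iff.mp (Finset.mem_range.mp hj)
    simp only [Prod.swap, Nat.choose_symm hj', Nat.cast_choose ℝ hj', zero_smul, add_zero,
      sub_zero, one_pow]
    have := Nat.factorial_ne_zero i
    field_simp
  rw [ht, Real.norm_eq_abs, one_smul, sub_zero, one_pow, mul_one] at hb
  refine hb.trans ?_
  have hnn : 0 ≤ 2 ^ (K + 1) * rad h ^ (K + 1) * CkNorm (K + 1) f := by
    have := rad_nonneg h
    have := CkNorm_nonneg (K + 1) f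
    positivity
  calc _ ≤ 2 ^ (K + 1) * rad h ^ (K + 1) * CkNorm (K + 1) f :=
        div_le_self hnn (by exact_mod_cast Nat.succ_le_of_lt (Nat.factorial_pos K))
    _ = _ := by ring

/-! ### The kernel and the operator `V` -/

/-- The kernel `h₁ / |h|²`. -/
noncomputable def kerV (h : ℝ × ℝ) : ℝ := h.1 / (h.1 ^ 2 + h.2 ^ 2)

lemma norm_le_rad (h : ℝ × ℝ) : ‖h‖ ≤ rad h :=
  max_le (abs_fst_le_rad h) (abs_snd_le_rad h)

lemma rad_pos {h : ℝ × ℝ} (hh : h ≠ 0) : 0 < rad h :=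
  (norm_pos_iff.mpr hh).trans_le (norm_le_rad h)

lemma rad_zero : rad 0 = 0 := by simp [rad]

lemma rad_smul {c : ℝ} (hc : 0 ≤ c) (h : ℝ × ℝ) : rad (c • h) = c * rad h := by
  simp only [rad, Prod.smul_fst, Prod.smul_snd, smul_eq_mul]
  rw [show (c * h.1) ^ 2 + (c * h.2) ^ 2 = c ^ 2 * (h.1 ^ 2 + h.2 ^ 2) by ring,
    Real.sqrt_mul (sq_nonneg c), Real.sqrt_sq hc]

lemma continuous_rad : Continuous rad := by
  unfold rad
  fun_prop

lemma abs_kerV_le (h : ℝ × ℝ) : |kerV h| ≤ (rad h)⁻¹ := by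
  by_cases hh : h = 0
  · simp [hh, kerV, rad_zero]
  · have hp := rad_pos hh
    rw [kerV, ← rad_sq, abs_div, abs_of_nonneg (sq_nonneg (rad h)), div_le_iff₀ (by positivity)]
    calc |h.1| ≤ rad h := abs_fst_le_rad h
      _ = (rad h)⁻¹ * rad h ^ 2 := by field_simp

lemma measurable_kerV : Measurable kerV := by
  unfold kerV
  fun_prop

lemma locallyIntegrable_of_le_inv_rad {φ : ℝ × ℝ → ℝ} (hm : Measurable φ)
    (hφ : ∀ h, |φ h| ≤ (rad h)⁻¹) : LocallyIntegrable φ := by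
  refine locallyIntegrable_of_norm_le_rpow (C := 1) (α := 1) (by simp) (by simp) ?_
    hm.aestronglyMeasurable
  filter_upwards [Measure.ae_ne volume 0] with h hh
  rw [Real.rpow_neg_one, one_mul]
  exact (hφ h).trans (inv_anti₀ (norm_pos_iff.mpr hh) (norm_le_rad h))

lemma locallyIntegrable_inv_rad : LocallyIntegrable fun h => (rad h)⁻¹ :=
  locallyIntegrable_of_le_inv_rad (continuous_rad.measurable.inv)
    fun h => (abs_of_nonneg (inv_nonneg.mpr (rad_nonneg h))).le

lemma locallyIntegrable_kerV : LocallyIntegrable kerV :=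
  locallyIntegrable_of_le_inv_rad measurable_kerV abs_kerV_le

lemma integrable_kerV_mul {φ : ℝ × ℝ → ℝ} (hc : Continuous φ) (hs : HasCompactSupport φ) :
    Integrable fun h => kerV h * φ h :=
  locallyIntegrable_kerV.integrable_smul_right_of_hasCompactSupport hc hs

lemma kerV_neg (h : ℝ × ℝ) : kerV (-h) = -kerV h := by
  simp [kerV, neg_div]

lemma locallyIntegrable_neg_kerV : LocallyIntegrable fun h => -kerV h :=
  locallyIntegrable_kerV.neg

lemma Vop_eq_convolution (w : ℝ × ℝ → ℝ) :
    Vop w = convolution (fun h => -kerV h) w (ContinuousLinearMap.mul ℝ ℝ) volume := by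
  funext x
  rw [convolution_def, ← integral_neg_eq_self]
  simp only [Vop, ContinuousLinearMap.mul_apply', kerV_neg, neg_neg, sub_neg_eq_add]
  rfl

lemma contDiff_Vop {n : ℕ} {w : ℝ × ℝ → ℝ} (hw : ContDiff ℝ n w) (hs : HasCompactSupport w) :
    ContDiff ℝ n (Vop w) := by
  rw [Vop_eq_convolution]
  exact hs.contDiff_convolution_right (n := (n : ℕ∞)) _ locallyIntegrable_neg_kerV hw

lemma dirD_Vop {w : ℝ × ℝ → ℝ} (hw : ContDiff ℝ 1 w) (hs : HasCompactSupport w) (v : ℝ × ℝ) :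
    dirD v (Vop w) = Vop (dirD v w) := by
  funext x
  rw [Vop_eq_convolution, Vop_eq_convolution, dirD,
    (hs.hasFDerivAt_convolution_right _ locallyIntegrable_neg_kerV hw x).fderiv,
    convolution_precompR_apply _ locallyIntegrable_neg_kerV (hs.fderiv ℝ)
      (hw.continuous_fderiv one_ne_zero)]
  rfl

lemma Vop_add_const_mul {u w : ℝ × ℝ → ℝ} (c : ℝ) (hu : Continuous u) (hus : HasCompactSupport u)
    (hw : Continuous w) (hws : HasCompactSupport w) :
    Vop (fun x => u x + c * w x) = fun x => Vop u x + c * Vop w x := by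
  funext x
  have hi : ∀ {φ : ℝ × ℝ → ℝ}, Continuous φ → HasCompactSupport φ →
      Integrable fun h => kerV h * φ (x + h) := fun hφ hφs =>
    integrable_kerV_mul (hφ.comp (continuous_const_add x))
      (hφs.comp_homeomorph (Homeomorph.addLeft x))
  have h := integral_add (hi hu hus) ((hi hw hws).const_mul c)
  rw [integral_const_mul] at h
  rw [Vop, Vop, Vop]
  refine Eq.trans (integral_congr_ae (Eventually.of_forall fun h => ?_)) h
  simp only [kerV]
  ring

/-! ### The approximation error and its derivatives -/

/-- The plane wave `sin (N (b x₁ + a x₂) + Θ)`. -/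
noncomputable def wave (N a b Θ : ℝ) (x : ℝ × ℝ) : ℝ := Real.sin (N * (b * x.1 + a * x.2) + Θ)

lemma contDiff_wave {n : WithTop ℕ∞} (N a b Θ : ℝ) : ContDiff ℝ n (wave N a b Θ) := by
  unfold wave
  exact Real.contDiff_sin.comp (by fun_prop)

lemma wave_add_pi_div_two (N a b Θ : ℝ) (x : ℝ × ℝ) :
    wave N a b (Θ + π / 2) x = Real.cos (N * (b * x.1 + a * x.2) + Θ) := by
  rw [wave, ← add_assoc, Real.sin_add_pi_div_two]

lemma dirD_wave (N a b Θ : ℝ) (v : ℝ × ℝ) :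
    dirD v (wave N a b Θ) = fun x => N * (b * v.1 + a * v.2) * wave N a b (Θ + π / 2) x := by
  funext x
  rw [wave_add_pi_div_two]
  have h1 : HasFDerivAt (fun x : ℝ × ℝ => N * (b * x.1 + a * x.2) + Θ)
      (N • (b • ContinuousLinearMap.fst ℝ ℝ ℝ + a • ContinuousLinearMap.snd ℝ ℝ ℝ)) x :=
    (((hasFDerivAt_fst.const_mul b).add (hasFDerivAt_snd.const_mul a)).const_mul N).add_const Θ
  have h2 := h1.sin
  change fderiv ℝ (fun x : ℝ × ℝ => Real.sin (N * (b * x.1 + a * x.2) + Θ)) x v = _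
  rw [h2.fderiv]
  simp
  ring

/-- The error `V(w) - V^K(w)` for `w = f · wave`. -/
noncomputable def Verr (cs cc : ℕ → ℕ → ℝ) (K : ℕ) (N a b Θ : ℝ) (f : ℝ × ℝ → ℝ) :
    ℝ × ℝ → ℝ :=
  fun x => Vop (fun y => f y * wave N a b Θ y) x - VKapprox cs cc K N a b Θ f x

lemma VKapprox_eq (cs cc : ℕ → ℕ → ℝ) (K : ℕ) (N a b Θ : ℝ) (f : ℝ × ℝ → ℝ) :
    VKapprox cs cc K N a b Θ f = fun x => ∑ i ∈ Finset.range (K + 1),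
      ∑ j ∈ Finset.range (i + 1), ((N ^ (i + 1))⁻¹ * pdMix (i - j) j f x) *
        (cs i j * wave N a b Θ x + cc i j * wave N a b (Θ + π / 2) x) := by
  funext x
  simp only [wave_add_pi_div_two]
  refine Finset.sum_congr rfl fun i _ => Finset.sum_congr rfl fun j _ => ?_
  rw [wave]
  ring

lemma contDiff_VKapprox {K n : ℕ} {f : ℝ × ℝ → ℝ} (hf : ContDiff ℝ (n + K : ℕ) f)
    (cs cc : ℕ → ℕ → ℝ) (N a b Θ : ℝ) : ContDiff ℝ n (VKapprox cs cc K N a b Θ f) := by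
  rw [VKapprox_eq]
  refine ContDiff.sum fun i hi => ContDiff.sum fun j hj => ?_
  rw [Finset.mem_range] at hi hj
  have := contDiff_wave (n := n) N a b Θ
  have := contDiff_wave (n := n) N a b (Θ + π / 2)
  have := contDiff_pdMix (n := n) (i := i - j) (j := j)
    (hf.of_le (by norm_cast; omega))
  fun_prop

lemma contDiff_Verr {K n : ℕ} {f : ℝ × ℝ → ℝ} (hf : ContDiff ℝ (n + K : ℕ) f) (hs : SuppBall f)
    (cs cc : ℕ → ℕ → ℝ) (N a b Θ : ℝ) : ContDiff ℝ n (Verr cs cc K N a b Θ f) :=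
  (contDiff_Vop ((hf.of_le (by norm_cast; omega)).mul (contDiff_wave N a b Θ))
    (hs.mul_right _).hasCompactSupport).sub (contDiff_VKapprox hf cs cc N a b Θ)

lemma dirD_VKapprox {K : ℕ} {f : ℝ × ℝ → ℝ} (hf : ContDiff ℝ (K + 2 : ℕ) f)
    (cs cc : ℕ → ℕ → ℝ) (N a b Θ : ℝ) (v : ℝ × ℝ) :
    dirD v (VKapprox cs cc K N a b Θ f) = fun x => VKapprox cs cc K N a b Θ (dirD v f) x
      + N * (b * v.1 + a * v.2) * VKapprox cs cc K N a b (Θ + π / 2) f x := by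
  have hw : ∀ Θ, Differentiable ℝ (wave N a b Θ) := fun Θ =>
    (contDiff_wave (n := 1) N a b Θ).differentiable one_ne_zero
  have hp : ∀ i ∈ Finset.range (K + 1), ∀ j ∈ Finset.range (i + 1),
      Differentiable ℝ (pdMix (i - j) j f) := fun i hi j hj => by
    rw [Finset.mem_range] at hi hj
    exact (contDiff_pdMix (n := 1) (hf.of_le (by norm_cast; omega))).differentiable
      (by simp)
  have hA : ∀ i j, Differentiable ℝ
      (fun x => cs i j * wave N a b Θ x + cc i j * wave N a b (Θ + π / 2) x) := fun i j =>
    ((hw _).const_mul _).add ((hw _).const_mul _)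
  simp only [VKapprox_eq]
  rw [dirD_sum _ fun i hi => Differentiable.fun_sum fun j hj =>
    ((hp i hi j hj).const_mul _).fun_mul (hA i j)]
  funext x
  rw [Finset.mul_sum, ← Finset.sum_add_distrib]
  refine Finset.sum_congr rfl fun i hi => ?_
  rw [dirD_sum _ fun j hj => ((hp i hi j hj).const_mul _).fun_mul (hA i j)]
  simp only []
  rw [Finset.mul_sum, ← Finset.sum_add_distrib]
  refine Finset.sum_congr rfl fun j hj => ?_
  rw [dirD_mul ((hp i hi j hj).const_mul _) (hA i j), dirD_const_mul,
    dirD_add ((hw _).const_mul _) ((hw _).const_mul _), dirD_const_mul, dirD_const_mul,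
    dirD_wave, dirD_wave, pdMix_dirD]
  · ring
  · rw [Finset.mem_range] at hi hj
    exact hf.of_le (by norm_cast; omega)

lemma dirD_Verr {K : ℕ} {f : ℝ × ℝ → ℝ} (hf : ContDiff ℝ (K + 2 : ℕ) f) (hs : SuppBall f)
    (cs cc : ℕ → ℕ → ℝ) (N a b Θ : ℝ) (v : ℝ × ℝ) :
    dirD v (Verr cs cc K N a b Θ f) = fun x => Verr cs cc K N a b Θ (dirD v f) x
      + N * (b * v.1 + a * v.2) * Verr cs cc K N a b (Θ + π / 2) f x := by
  have hw : ∀ Θ, ContDiff ℝ 1 (wave N a b Θ) := fun Θ => contDiff_wave N a b Θ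
  have hf1 : ContDiff ℝ 1 f := hf.of_le (by norm_cast; omega)
  have hdf : ContDiff ℝ (0 : ℕ) (dirD v f) := contDiff_dirD hf1 v
  have hcs : ∀ {u : ℝ × ℝ → ℝ} (Θ), SuppBall u →
      HasCompactSupport fun x => u x * wave N a b Θ x :=
    fun Θ hu => (hu.mul_right _).hasCompactSupport
  have hV : ContDiff ℝ (1 : ℕ) (Vop fun y => f y * wave N a b Θ y) :=
    contDiff_Vop (by exact_mod_cast hf1.mul (hw Θ)) (hcs Θ hs)
  have hVK : ContDiff ℝ (1 : ℕ) (VKapprox cs cc K N a b Θ f) :=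
    contDiff_VKapprox (hf.of_le (by norm_cast; omega)) _ _ _ _ _ _
  unfold Verr
  rw [dirD_sub (hV.differentiable (by simp)) (hVK.differentiable (by simp)),
    dirD_VKapprox hf, dirD_Vop (hf1.mul (hw Θ)) (hcs Θ hs),
    dirD_mul (hf1.differentiable one_ne_zero) ((hw Θ).differentiable one_ne_zero), dirD_wave]
  have h := Vop_add_const_mul (u := fun x => dirD v f x * wave N a b Θ x)
    (w := fun x => f x * wave N a b (Θ + π / 2) x) (N * (b * v.1 + a * v.2))
    (hdf.continuous.mul (hw Θ).continuous) (hcs Θ (hs.dirD v))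
    (hf1.continuous.mul (hw (Θ + π / 2)).continuous) (hcs (Θ + π / 2) hs)
  funext x
  have e : (fun x => dirD v f x * wave N a b Θ x +
      f x * (N * (b * v.1 + a * v.2) * wave N a b (Θ + π / 2) x)) =
      fun x => dirD v f x * wave N a b Θ x +
      N * (b * v.1 + a * v.2) * (f x * wave N a b (Θ + π / 2) x) := by
    funext x
    ring
  simp only []
  rw [e, h]
  ring

/-- The right-hand side of the approximation estimate. -/
noncomputable def errBound (K : ℕ) (ε N : ℝ) (J : ℕ) (f : ℝ × ℝ → ℝ) : ℝ :=
  (∑ i ∈ Finset.range (K + 1),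
    N ^ ((i : ℝ) * ε + (J : ℝ) - (K : ℝ)) * CkNorm (K - i + J) f)
    + N ^ ((J : ℝ) - ((K : ℝ) + 2) * ε) * CkNorm (K + J + 1) f

lemma errBound_le_succ {K J : ℕ} {ε N : ℝ} (hN : 0 < N) {u f : ℝ × ℝ → ℝ} {c : ℝ}
    (h : ∀ k ≤ K + J + 1, c * CkNorm k u ≤ N * CkNorm (k + 1) f) :
    c * errBound K ε N J u ≤ errBound K ε N (J + 1) f := by
  have e : ∀ x : ℝ, N ^ (x + 1) = N ^ x * N := fun x => Real.rpow_add_one hN.ne' x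
  rw [errBound, errBound, mul_add, Finset.mul_sum]
  push_cast
  have key : ∀ x y : ℝ, y = x + 1 → ∀ k ≤ K + J + 1,
      c * (N ^ x * CkNorm k u) ≤ N ^ y * CkNorm (k + 1) f := by
    rintro x y rfl k hk
    rw [e, mul_left_comm, mul_assoc]
    exact mul_le_mul_of_nonneg_left (h k hk) (Real.rpow_nonneg hN.le x)
  refine add_le_add (Finset.sum_le_sum fun i hi => ?_) ?_
  · exact key _ _ (by ring) _ (by omega)
  · exact key _ _ (by ring) _ le_rfl

lemma errBound_nonneg (K J : ℕ) {ε N : ℝ} (hN : 0 < N) (f : ℝ × ℝ → ℝ) :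
    0 ≤ errBound K ε N J f :=
  add_nonneg (Finset.sum_nonneg fun _ _ => mul_nonneg (Real.rpow_nonneg hN.le _)
    (CkNorm_nonneg _ _)) (mul_nonneg (Real.rpow_nonneg hN.le _) (CkNorm_nonneg _ _))

lemma errBound_pd_le {K J : ℕ} {ε N : ℝ} (hN : 1 ≤ N) {f : ℝ × ℝ → ℝ}
    (hf : ContDiff ℝ (K + J + 2 : ℕ) f) (hs : SuppBall f) :
    errBound K ε N J (pd1 f) ≤ errBound K ε N (J + 1) f ∧
      errBound K ε N J (pd2 f) ≤ errBound K ε N (J + 1) f ∧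
      N * errBound K ε N J f ≤ errBound K ε N (J + 1) f := by
  have hN0 : 0 < N := by linarith
  have hk : ∀ k ≤ K + J + 1, ContDiff ℝ (k + 1 : ℕ) f := fun k hk =>
    hf.of_le (by norm_cast; omega)
  refine ⟨?_, ?_, errBound_le_succ hN0 fun k hk' => ?_⟩
  · rw [← one_mul (errBound K ε N J _)]
    exact errBound_le_succ hN0 fun k hk' =>
      mul_le_mul hN (CkNorm_pd1_le (hk k hk') hs) (CkNorm_nonneg _ _) hN0.le
  · rw [← one_mul (errBound K ε N J _)]
    exact errBound_le_succ hN0 fun k hk' =>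
      mul_le_mul hN (CkNorm_pd2_le (hk k hk') hs) (CkNorm_nonneg _ _) hN0.le
  · exact mul_le_mul_of_nonneg_left (CkNorm_mono (hk k hk') hs (Nat.le_succ k)) hN0.le

lemma errBound_mono {K J n : ℕ} {ε N : ℝ} (hN : 1 ≤ N) {f : ℝ × ℝ → ℝ}
    (hf : ContDiff ℝ (K + J + 2 : ℕ) f) (hs : SuppBall f) (hn : n ≤ J) :
    errBound K ε N n f ≤ errBound K ε N J f := by
  induction J, hn using Nat.le_induction with
  | base => exact le_rfl
  | succ J hn ih =>
    have hf' : ContDiff ℝ (K + J + 2 : ℕ) f := hf.of_le (by norm_cast; omega)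
    refine (ih hf').trans (le_trans ?_ (errBound_pd_le hN hf' hs).2.2)
    exact le_mul_of_one_le_left (errBound_nonneg K J (by linarith) f) hN

/-- A uniform bound for the error propagates to all its partial derivatives. -/
lemma abs_pdMix_Verr_le {cs cc : ℕ → ℕ → ℝ} {K : ℕ} {ε N a b C : ℝ} (hN : 1 ≤ N)
    (hab : a ^ 2 + b ^ 2 = 1)
    (hbase : ∀ (Θ : ℝ) (f : ℝ × ℝ → ℝ), ContDiff ℝ (K + 2 : ℕ) f → SuppBall f →
      ∀ x, |Verr cs cc K N a b Θ f x| ≤ C * errBound K ε N 0 f) (hC : 0 ≤ C)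
    {n : ℕ} {f : ℝ × ℝ → ℝ} (hf : ContDiff ℝ (K + n + 2 : ℕ) f) (hs : SuppBall f) (Θ : ℝ)
    {i j : ℕ} (hij : i + j = n) (x : ℝ × ℝ) :
    |pdMix i j (Verr cs cc K N a b Θ f) x| ≤ 2 ^ n * C * errBound K ε N n f := by
  have ha : |a| ≤ 1 := abs_le_one_iff_mul_self_le_one.mpr (by nlinarith [sq_nonneg b])
  have hb : |b| ≤ 1 := abs_le_one_iff_mul_self_le_one.mpr (by nlinarith [sq_nonneg a])
  induction n generalizing f Θ i j with
  | zero =>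
    obtain ⟨rfl, rfl⟩ : i = 0 ∧ j = 0 := by omega
    simpa [pdMix] using hbase Θ f hf hs x
  | succ n ih =>
    have step : ∀ (v : ℝ × ℝ) (i j : ℕ), i + j = n → |b * v.1 + a * v.2| ≤ 1 →
        errBound K ε N n (dirD v f) ≤ errBound K ε N (n + 1) f →
        |pdMix i j (dirD v (Verr cs cc K N a b Θ f)) x|
          ≤ 2 ^ (n + 1) * C * errBound K ε N (n + 1) f := by
      intro v i j hij hv hbd
      have hfn : ContDiff ℝ (K + n + 2 : ℕ) f := hf.of_le (by norm_cast; omega)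
      have hdf : ContDiff ℝ (K + n + 2 : ℕ) (dirD v f) :=
        contDiff_dirD (hf.of_le (by norm_cast)) v
      rw [dirD_Verr (hf.of_le (by norm_cast; omega)) hs, pdMix_add
        (contDiff_Verr (hdf.of_le (by norm_cast; omega)) (hs.dirD v) _ _ _ _ _ _)
        (contDiff_const.mul
          (contDiff_Verr (hfn.of_le (by norm_cast; omega)) hs _ _ _ _ _ _)), pdMix_const_mul]
      have h1 := ih hdf (hs.dirD v) Θ hij
      have h2 := ih hfn hs (Θ + π / 2) hij
      have h3 := (errBound_pd_le (ε := ε) hN hfn hs).2.2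
      calc _ ≤ |pdMix i j (Verr cs cc K N a b Θ (dirD v f)) x| +
            |N * (b * v.1 + a * v.2) * pdMix i j (Verr cs cc K N a b (Θ + π / 2) f) x| :=
            abs_add_le _ _
        _ ≤ 2 ^ n * C * errBound K ε N (n + 1) f +
            N * 1 * (2 ^ n * C * errBound K ε N n f) := by
            rw [abs_mul, abs_mul, abs_of_pos (by linarith : 0 < N)]
            gcongr
            exact h1.trans (by gcongr)
        _ = 2 ^ n * C * errBound K ε N (n + 1) f +
            2 ^ n * C * (N * errBound K ε N n f) := by ring
        _ ≤ 2 ^ n * C * errBound K ε N (n + 1) f +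
            2 ^ n * C * errBound K ε N (n + 1) f := by gcongr
        _ = _ := by ring
    have hp := errBound_pd_le (ε := ε) hN (K := K) (J := n)
      (hf.of_le (by norm_cast; omega)) hs
    rcases j with _ | j
    · obtain ⟨i, rfl⟩ : ∃ i', i = i' + 1 := ⟨i - 1, by omega⟩
      exact step (1, 0) i 0 (by omega) (by simpa using hb) hp.1
    · exact step (0, 1) i j (by omega) (by simpa using ha) hp.2.1

/-! ### Oscillatory integrals -/

lemma abs_wave_le_one (N a b Θ : ℝ) (x : ℝ × ℝ) : |wave N a b Θ x| ≤ 1 := Real.abs_sin_le_one _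

/-- Repeated integration by parts along the direction of oscillation. -/
lemma abs_integral_mul_wave_le {m : ℕ} {u : ℝ × ℝ → ℝ} (hu : ContDiff ℝ m u)
    (hs : HasCompactSupport u) {N a b : ℝ} (hN : 0 < N) (hab : a ^ 2 + b ^ 2 = 1) (Θ : ℝ) :
    |∫ h, u h * wave N a b Θ h| ≤ (N ^ m)⁻¹ * ∫ h, |(dirD (b, a))^[m] u h| := by
  induction m generalizing u Θ with
  | zero =>
    simp only [pow_zero, inv_one, one_mul, Function.iterate_zero, id]
    rw [← Real.norm_eq_abs]
    refine norm_integral_le_of_norm_le (g := fun h => |u h|)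
      (hu.continuous.integrable_of_hasCompactSupport (μ := volume) hs).abs
      (Eventually.of_forall fun h => ?_)
    rw [Real.norm_eq_abs, abs_mul]
    exact mul_le_of_le_one_right (abs_nonneg _) (abs_wave_le_one _ _ _ _ _)
  | succ m ih =>
    have hw : ∀ Θ, ContDiff ℝ 1 (wave N a b Θ) := fun Θ => contDiff_wave N a b Θ
    have hd : ∀ h, fderiv ℝ (wave N a b (Θ - π / 2)) h (b, a) = N * wave N a b Θ h := by
      intro h
      have := congrFun (dirD_wave N a b (Θ - π / 2) (b, a)) h
      rw [sub_add_cancel, show b * (b, a).1 + a * (b, a).2 = 1 by simp; linarith, mul_one]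
        at this
      exact this
    have hdu : ContDiff ℝ m (dirD (b, a) u) := contDiff_dirD hu _
    have hdus : HasCompactSupport (dirD (b, a) u) := hs.fderiv_apply ℝ _
    have hwc := (hw (Θ - π / 2)).continuous
    have ibp := integral_mul_fderiv_eq_neg_fderiv_mul_of_integrable (μ := volume)
      (f := u) (g := wave N a b (Θ - π / 2)) (v := (b, a))
      ((hdu.continuous.mul hwc).integrable_of_hasCompactSupport hdus.mul_right)
      (by
        simp only [hd]
        exact (hu.continuous.mul (continuous_const.mul
          (hw Θ).continuous)).integrable_of_hasCompactSupport hs.mul_right)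
      ((hu.continuous.mul hwc).integrable_of_hasCompactSupport hs.mul_right)
      (fun x _ => (hu.differentiable (by simp)) x)
      (fun x _ => ((hw _).differentiable one_ne_zero) x)
    simp only [hd] at ibp
    have e : ∫ h, u h * wave N a b Θ h
        = -(N⁻¹ * ∫ h, dirD (b, a) u h * wave N a b (Θ - π / 2) h) := by
      have ibp' : ∫ h, u h * (N * wave N a b Θ h)
          = -∫ h, dirD (b, a) u h * wave N a b (Θ - π / 2) h := ibp
      simp only [mul_left_comm (u _)] at ibp'
      rw [integral_const_mul] at ibp'
      rw [← mul_neg, ← ibp']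
      field_simp
    rw [e, abs_neg, abs_mul, abs_of_pos (inv_pos.mpr hN), pow_succ, mul_inv_rev, mul_assoc]
    exact mul_le_mul_of_nonneg_left (ih hdu hdus _) (inv_nonneg.mpr hN.le)

/-! ### Cut-off kernels -/

lemma rad_eq_one {a b : ℝ} (hab : a ^ 2 + b ^ 2 = 1) : rad (b, a) = 1 := by
  simp [rad, add_comm (b ^ 2), hab]

lemma contDiffAt_rad {n : WithTop ℕ∞} {h : ℝ × ℝ} (hh : h ≠ 0) : ContDiffAt ℝ n rad h := by
  refine ContDiffAt.sqrt (by fun_prop) ?_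
  rw [← rad_sq]
  exact (pow_pos (rad_pos hh) 2).ne'

lemma contDiffAt_kerV {n : WithTop ℕ∞} {h : ℝ × ℝ} (hh : h ≠ 0) : ContDiffAt ℝ n kerV h := by
  refine ContDiffAt.div (by fun_prop) (by fun_prop) ?_
  rw [← rad_sq]
  exact (pow_pos (rad_pos hh) 2).ne'

lemma contDiff_mul_cutoff {P : ℝ × ℝ → ℝ} {n : WithTop ℕ∞} (hP : ∀ h ≠ 0, ContDiffAt ℝ n P h)
    {q : ℝ → ℝ} (hq : ContDiff ℝ n q) (h0 : ∀ r ≤ 1 / 2, q r = 0) :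
    ContDiff ℝ n fun h => P h * q (rad h) := by
  rw [contDiff_iff_contDiffAt]
  intro h
  by_cases hh : h = 0
  · refine (contDiffAt_const (c := (0 : ℝ))).congr_of_eventuallyEq ?_
    have : ∀ᶠ k in nhds h, rad k < 1 / 2 :=
      continuous_rad.continuousAt.eventually_lt_const (by rw [hh, rad_zero]; norm_num)
    filter_upwards [this] with k hk
    rw [h0 _ hk.le, mul_zero]
  · exact (hP h hh).mul (hq.contDiffAt.comp h (contDiffAt_rad hh))

lemma exists_abs_dirD_iterate_le {u : ℝ × ℝ → ℝ} {l : ℕ} (hu : ContDiff ℝ l u)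
    {S : Set (ℝ × ℝ)} (hS : IsCompact S) :
    ∃ M, 0 ≤ M ∧ ∀ a b : ℝ, a ^ 2 + b ^ 2 = 1 → ∀ x ∈ S, |(dirD (b, a))^[l] u x| ≤ M := by
  have h : ∀ p : ℕ × ℕ, ∃ M : ℝ, p.1 + p.2 = l → ∀ x ∈ S, |pdMix p.1 p.2 u x| ≤ M := by
    intro p
    by_cases hp : p.1 + p.2 = l
    · have hc : Continuous (pdMix p.1 p.2 u) :=
        (contDiff_pdMix (n := 0) (hu.of_le (by norm_cast; omega))).continuous
      obtain ⟨M, hM⟩ := hS.exists_bound_of_continuousOn hc.continuousOn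
      exact ⟨M, fun _ x hx => hM x hx⟩
    · exact ⟨0, fun h => absurd h hp⟩
  choose M hM using h
  have hM0 : 0 ≤ ∑ p ∈ Finset.HasAntidiagonal.antidiagonal l, |M p| :=
    Finset.sum_nonneg fun _ _ => abs_nonneg _
  refine ⟨2 ^ l * ∑ p ∈ Finset.HasAntidiagonal.antidiagonal l, |M p|, by positivity,
    fun a b hab x hx => ?_⟩
  refine (abs_dirD_iterate_le (M := ∑ p ∈ Finset.HasAntidiagonal.antidiagonal l, |M p|)
    hu (b, a) x fun i j hij => ?_).trans_eq (by rw [rad_eq_one hab, one_pow, mul_one])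
  refine (hM (i, j) hij x hx).trans ((le_abs_self _).trans ?_)
  exact Finset.single_le_sum (f := fun p => |M p|) (fun _ _ => abs_nonneg _)
    (Finset.HasAntidiagonal.mem_antidiagonal.mpr hij)

/-- The kernel `h₁ / |h|²` cut off near the origin. -/
noncomputable def farKer (g : ℝ → ℝ) (h : ℝ × ℝ) : ℝ := kerV h * (1 - g (rad h))

lemma contDiff_farKer {g : ℝ → ℝ} (hg : IsCutoff g) : ContDiff ℝ (⊤ : ℕ∞) (farKer g) :=
  contDiff_mul_cutoff (q := fun r => 1 - g r) (fun _ hh => contDiffAt_kerV hh)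
    (contDiff_const.sub hg.1) fun r hr => by rw [hg.2.2.1 r hr, sub_self]

lemma kerV_smul {c : ℝ} (hc : c ≠ 0) (h : ℝ × ℝ) : kerV (c • h) = c⁻¹ * kerV h := by
  by_cases hh : h = 0
  · simp [hh, kerV]
  · have : h.1 ^ 2 + h.2 ^ 2 ≠ 0 := by
      rw [← rad_sq]
      exact (pow_pos (rad_pos hh) 2).ne'
    simp only [kerV, Prod.smul_fst, Prod.smul_snd, smul_eq_mul]
    rw [show (c * h.1) ^ 2 + (c * h.2) ^ 2 = c ^ 2 * (h.1 ^ 2 + h.2 ^ 2) by ring]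
    field_simp

/-- Derivatives of the cut-off kernel decay at least like the kernel itself. -/
lemma exists_dirD_iterate_farKer_le {g : ℝ → ℝ} (hg : IsCutoff g) (l : ℕ) :
    ∃ C, 0 ≤ C ∧ ∀ a b : ℝ, a ^ 2 + b ^ 2 = 1 → ∀ h,
      |(dirD (b, a))^[l] (farKer g) h| ≤ C * (rad h)⁻¹ := by
  obtain ⟨M, hM0, hM⟩ := exists_abs_dirD_iterate_le (l := l)
    ((contDiff_farKer hg).of_le (by exact_mod_cast le_top)) (isCompact_sq_le 4)
  refine ⟨2 * M, by positivity, fun a b hab h => ?_⟩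
  have hM' : ∀ k, rad k ≤ 2 → |(dirD (b, a))^[l] (farKer g) k| ≤ M := fun k hk =>
    hM a b hab k (by
      rw [Set.mem_ofPred_eq, ← rad_sq]
      nlinarith [rad_nonneg k])
  by_cases hh : h = 0
  · have h1 : farKer g =ᶠ[nhds h] fun _ => 0 := by
      have : ∀ᶠ k in nhds h, rad k < 1 / 2 :=
        continuous_rad.continuousAt.eventually_lt_const (by rw [hh, rad_zero]; norm_num)
      filter_upwards [this] with k hk
      rw [farKer, hg.2.2.1 _ hk.le, sub_self, mul_zero]
    rw [(dirD_iterate_congr_nhds h1 (b, a) l).eq_of_nhds, dirD_iterate_zero, hh, rad_zero]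
    simp
  have hr := rad_pos hh
  rcases le_or_gt (rad h) 2 with h2 | h2
  · refine (hM' h h2).trans ?_
    rw [← div_eq_mul_inv, le_div_iff₀ hr]
    nlinarith
  · set r := rad h / 2 with hrdef
    have hr1 : 1 < r := by rw [hrdef]; linarith
    have hr0 : 0 < r := by linarith
    have hri : 0 ≤ r⁻¹ := inv_nonneg.mpr hr0.le
    have hrh : rad (r⁻¹ • h) = 2 := by
      rw [rad_smul hri, hrdef]
      field_simp
    have hev : farKer g =ᶠ[nhds h] fun k => r⁻¹ * farKer g (r⁻¹ • k) := by
      have h3 : ∀ᶠ k in nhds h, r < rad k :=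
        continuous_rad.continuousAt.eventually_const_lt (by rw [hrdef]; linarith)
      filter_upwards [h3] with k hk
      have e1 : g (rad k) = 0 := hg.2.2.2 _ (by linarith)
      have e2 : g (rad (r⁻¹ • k)) = 0 := hg.2.2.2 _ (by
        rw [rad_smul hri, inv_mul_eq_div, le_div_iff₀ hr0]
        linarith)
      rw [farKer, farKer, e1, e2, kerV_smul (inv_ne_zero hr0.ne')]
      field_simp
    rw [(dirD_iterate_congr_nhds hev (b, a) l).eq_of_nhds, dirD_iterate_const_mul,
      dirD_iterate_comp_smul, abs_mul, abs_mul, abs_of_nonneg hri,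
      abs_of_nonneg (pow_nonneg hri l)]
    calc r⁻¹ * (r⁻¹ ^ l * |(dirD (b, a))^[l] (farKer g) (r⁻¹ • h)|)
        ≤ r⁻¹ * (1 * M) := by
          gcongr
          · exact pow_le_one₀ hri (inv_le_one_of_one_le₀ hr1.le)
          · exact hM' _ hrh.le
      _ = 2 * M * (rad h)⁻¹ := by
          rw [hrdef]
          field_simp

/-- The Taylor monomial `h₁^{i-j} h₂^j / ((i-j)! j!)`. -/
noncomputable def taylorMono (i j : ℕ) (h : ℝ × ℝ) : ℝ :=
  h.1 ^ (i - j) * h.2 ^ j / ((Nat.factorial (i - j) : ℝ) * (Nat.factorial j : ℝ))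

lemma contDiff_taylorMono {n : WithTop ℕ∞} (i j : ℕ) : ContDiff ℝ n (taylorMono i j) := by
  unfold taylorMono
  fun_prop

lemma taylorMono_smul {i j : ℕ} (hj : j ≤ i) (c : ℝ) (h : ℝ × ℝ) :
    taylorMono i j (c • h) = c ^ i * taylorMono i j h := by
  simp only [taylorMono, Prod.smul_fst, Prod.smul_snd, smul_eq_mul, mul_pow]
  rw [show c ^ i = c ^ (i - j) * c ^ j by rw [← pow_add, Nat.sub_add_cancel hj]]
  ring

/-- The kernel moments at inverse cutoff radius `s`. -/
noncomputable def moment (g : ℝ → ℝ) (a b : ℝ) (i j : ℕ) (Θ s : ℝ) : ℝ :=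
  ∫ h : ℝ × ℝ, kerV h * (taylorMono i j h * wave 1 a b Θ h * g (s * rad h))

lemma Tijs_eq_moment (g : ℝ → ℝ) (ε a b : ℝ) (i j : ℕ) (N : ℝ) :
    Tijs g ε a b i j N = moment g a b i j (π / 2) (N ^ (ε - 1)) := by
  refine integral_congr_ae (Eventually.of_forall fun h => ?_)
  simp only [wave, kerV, taylorMono, Real.sin_add_pi_div_two, one_mul, add_comm (b * h.1)]
  ring

lemma Tijc_eq_moment (g : ℝ → ℝ) (ε a b : ℝ) (i j : ℕ) (N : ℝ) :
    Tijc g ε a b i j N = moment g a b i j 0 (N ^ (ε - 1)) := by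
  refine integral_congr_ae (Eventually.of_forall fun h => ?_)
  simp only [wave, kerV, taylorMono, add_zero, one_mul, add_comm (b * h.1)]
  ring

lemma hasCompactSupport_of_rad {φ : ℝ × ℝ → ℝ} (R : ℝ) (h : ∀ x, R ≤ rad x → φ x = 0) :
    HasCompactSupport φ := by
  refine HasCompactSupport.intro (isCompact_sq_le (R ^ 2)) fun x hx => h x ?_
  rw [Set.mem_ofPred_eq, ← rad_sq, not_le] at hx
  exact (le_abs_self R).trans (abs_le_of_sq_le_sq hx.le (rad_nonneg x))

lemma hasCompactSupport_cutoff {g : ℝ → ℝ} (hg : IsCutoff g) {s : ℝ} (hs : 0 < s) :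
    HasCompactSupport fun h => g (s * rad h) :=
  hasCompactSupport_of_rad s⁻¹ fun x hx => hg.2.2.2 _ (by
    calc (1 : ℝ) = s * s⁻¹ := (mul_inv_cancel₀ hs.ne').symm
      _ ≤ s * rad x := by gcongr)

lemma continuous_cutoff {g : ℝ → ℝ} (hg : IsCutoff g) (s : ℝ) :
    Continuous fun h => g (s * rad h) :=
  hg.1.continuous.comp (continuous_const.mul continuous_rad)

lemma integrable_kerV_mul_cutoff {g : ℝ → ℝ} (hg : IsCutoff g) {s : ℝ} (hs : 0 < s)
    {φ : ℝ × ℝ → ℝ} (hφ : Continuous φ) :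
    Integrable fun h => kerV h * (φ h * g (s * rad h)) :=
  integrable_kerV_mul (hφ.mul (continuous_cutoff hg s)) (hasCompactSupport_cutoff hg hs).mul_left

/-- Doubling the cutoff radius changes the moments by a rapidly decaying amount. -/
lemma exists_abs_moment_half_sub_le {g : ℝ → ℝ} (hg : IsCutoff g) {i j : ℕ} (hj : j ≤ i)
    (k : ℕ) : ∃ C, 0 ≤ C ∧ ∀ a b : ℝ, a ^ 2 + b ^ 2 = 1 → ∀ Θ s : ℝ, 0 < s →
      |moment g a b i j Θ (s / 2) - moment g a b i j Θ s| ≤ C * s ^ k := by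
  set q : ℝ → ℝ := fun r => g (r / 2) - g r with hq
  set Q : ℝ × ℝ → ℝ := fun h => kerV h * taylorMono i j h * q (rad h) with hQ
  set m : ℕ := i + 1 + k with hm
  have hQd : ContDiff ℝ (⊤ : ℕ∞) Q := by
    refine contDiff_mul_cutoff
      (fun h hh => (contDiffAt_kerV hh).mul (contDiff_taylorMono i j).contDiffAt)
      ((hg.1.comp (contDiff_id.div_const 2)).sub hg.1) fun r hr => ?_
    change g (r / 2) - g r = 0
    rw [hg.2.2.1 r hr, hg.2.2.1 (r / 2) ?_, sub_self]
    linarith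
  have hQm : ContDiff ℝ m Q := hQd.of_le (by exact_mod_cast le_top)
  have hQ0 : ∀ x, 2 ≤ rad x → Q x = 0 := fun x hx => by
    simp only [hQ, hq]
    rw [hg.2.2.2 (rad x) (by linarith), hg.2.2.2 (rad x / 2) (by linarith)]
    simp
  have hQc : HasCompactSupport Q := hasCompactSupport_of_rad 2 hQ0
  obtain ⟨M, hM0, hM⟩ := exists_abs_dirD_iterate_le hQm hQc
  refine ⟨M * volume.real (tsupport Q), by positivity, fun a b hab Θ s hs => ?_⟩
  have hint : ∫ h, |(dirD (b, a))^[m] Q h| ≤ M * volume.real (tsupport Q) := by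
    have hz : ∀ x, x ∉ tsupport Q → |(dirD (b, a))^[m] Q x| = 0 := by
      intro x hx
      have h1 : Q =ᶠ[nhds x] fun _ => 0 := notMem_tsupport_iff_eventuallyEq.mp hx
      rw [(dirD_iterate_congr_nhds h1 (b, a) m).eq_of_nhds, dirD_iterate_zero, abs_zero]
    rw [← setIntegral_eq_integral_of_forall_compl_eq_zero hz]
    refine (le_abs_self _).trans ?_
    rw [← Real.norm_eq_abs]
    refine norm_setIntegral_le_of_norm_le_const hQc.measure_lt_top fun x hx => ?_
    rw [Real.norm_eq_abs, abs_abs]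
    exact hM a b hab x hx
  have hscale : ∀ h, kerV h * taylorMono i j h * q (s * rad h)
      = s * (s ^ i)⁻¹ * Q (s • h) := by
    intro h
    simp only [hQ]
    rw [kerV_smul hs.ne', taylorMono_smul hj, rad_smul hs.le]
    field_simp
  have hdiff : moment g a b i j Θ (s / 2) - moment g a b i j Θ s
      = ∫ h, s * (s ^ i)⁻¹ * Q (s • h) * wave 1 a b Θ h := by
    have hφ : Continuous fun h => taylorMono i j h * wave 1 a b Θ h :=
      (contDiff_taylorMono (n := 0) i j).continuous.mul
        (contDiff_wave (n := 0) 1 a b Θ).continuous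
    rw [moment, moment, ← integral_sub (integrable_kerV_mul_cutoff hg (by positivity) hφ)
      (integrable_kerV_mul_cutoff hg hs hφ)]
    refine integral_congr_ae (Eventually.of_forall fun h => ?_)
    simp only []
    rw [← hscale, hq]
    simp only []
    rw [show s * rad h / 2 = s / 2 * rad h by ring]
    ring
  have hQs : ContDiff ℝ m fun h => s * (s ^ i)⁻¹ * Q (s • h) :=
    contDiff_const.mul (hQm.comp (contDiff_const_smul s))
  have hQsc : HasCompactSupport fun h => s * (s ^ i)⁻¹ * Q (s • h) :=
    (hQc.comp_smul hs.ne').mul_left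
  have hmain := abs_integral_mul_wave_le hQs hQsc one_pos hab Θ
  rw [hdiff]
  refine hmain.trans ?_
  rw [one_pow, inv_one, one_mul, dirD_iterate_const_mul, dirD_iterate_comp_smul]
  simp only [abs_mul]
  rw [integral_const_mul, integral_const_mul,
    Measure.integral_comp_smul volume (fun h => |(dirD (b, a))^[m] Q h|)]
  simp only [Module.finrank_prod, Module.finrank_self, smul_eq_mul]
  rw [abs_of_pos hs, abs_of_pos (by positivity : 0 < (s ^ i)⁻¹), abs_of_pos
    (by positivity : 0 < s ^ m), abs_of_pos (by positivity : 0 < (s ^ (1 + 1))⁻¹)]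
  calc s * (s ^ i)⁻¹ * (s ^ m * ((s ^ (1 + 1))⁻¹ * ∫ h, |(dirD (b, a))^[m] Q h|))
      = s ^ k * ∫ h, |(dirD (b, a))^[m] Q h| := by
        rw [hm, pow_add, pow_add]
        field_simp
    _ ≤ s ^ k * (M * volume.real (tsupport Q)) := by gcongr
    _ = _ := by ring

/-- The moments converge rapidly to their limits. -/
lemma exists_abs_moment_sub_limit_le {g : ℝ → ℝ} (hg : IsCutoff g) {i j : ℕ} (hj : j ≤ i)
    {ε : ℝ} (hε : ε < 1) {k : ℕ} (hk : 1 ≤ k) :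
    ∃ C, 0 ≤ C ∧ ∀ a b : ℝ, a ^ 2 + b ^ 2 = 1 → ∀ Θ N c : ℝ, 1 ≤ N →
      Tendsto (fun M : ℝ => moment g a b i j Θ (M ^ (ε - 1))) atTop (nhds c) →
      |moment g a b i j Θ (N ^ (ε - 1)) - c| ≤ C * (N ^ (ε - 1)) ^ k := by
  obtain ⟨C, hC0, hC⟩ := exists_abs_moment_half_sub_le hg hj k
  refine ⟨2 * C, by positivity, fun a b hab Θ N c hN hc => ?_⟩
  set s := N ^ (ε - 1) with hs
  have hN0 : 0 < N := by linarith
  have hs0 : 0 < s := Real.rpow_pos_of_pos hN0 _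
  have htel : ∀ n : ℕ, |moment g a b i j Θ (s / 2 ^ n) - moment g a b i j Θ s|
      ≤ 2 * C * s ^ k * (1 - (1 / 2) ^ n) := by
    intro n
    induction n with
    | zero => simp
    | succ n ih =>
      have h1 := hC a b hab Θ (s / 2 ^ n) (by positivity)
      have h2 : (s / 2 ^ n) ^ k ≤ s ^ k * (1 / 2) ^ n := by
        rw [div_pow, ← pow_mul, div_eq_mul_inv, one_div, inv_pow]
        gcongr
        · norm_num
        · exact Nat.le_mul_of_pos_right n hk
      rw [show s / 2 ^ (n + 1) = s / 2 ^ n / 2 by rw [pow_succ]; field_simp]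
      calc _ ≤ _ := abs_sub_le _ (moment g a b i j Θ (s / 2 ^ n)) _
        _ ≤ C * (s ^ k * (1 / 2) ^ n) + 2 * C * s ^ k * (1 - (1 / 2) ^ n) :=
          add_le_add (h1.trans (by gcongr)) ih
        _ = _ := by ring
  have hlim : Tendsto (fun n : ℕ => moment g a b i j Θ (s / 2 ^ n)) atTop (nhds c) := by
    have hp : 0 < (1 - ε)⁻¹ := inv_pos.mpr (by linarith)
    have h1 : Tendsto (fun n : ℕ => N * ((2 : ℝ) ^ n) ^ (1 - ε)⁻¹) atTop atTop :=
      ((tendsto_rpow_atTop hp).comp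
        (tendsto_pow_atTop_atTop_of_one_lt one_lt_two)).const_mul_atTop hN0
    refine (hc.comp h1).congr fun n => ?_
    simp only [Function.comp]
    congr 1
    rw [Real.mul_rpow hN0.le (by positivity), ← Real.rpow_mul (by positivity),
      show (1 - ε)⁻¹ * (ε - 1) = -1 by
        have : 1 - ε ≠ 0 := by linarith
        field_simp
        ring,
      Real.rpow_neg_one, div_eq_mul_inv]
  rw [abs_sub_comm]
  refine le_of_tendsto ((hlim.sub_const _).abs) (Eventually.of_forall fun n => ?_)
  refine (htel n).trans ?_
  have : (0 : ℝ) ≤ (1 / 2) ^ n := by positivity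
  have h3 : 0 ≤ 2 * C * s ^ k := by positivity
  nlinarith

/-! ### The far and near parts of the integral -/

/-- The unit ball `{|x + h| ≤ 1}` in the variable `h`. -/
def shiftBall (x : ℝ × ℝ) : Set (ℝ × ℝ) :=
  {h | (x + h).1 ^ 2 + (x + h).2 ^ 2 ≤ 1}

lemma isCompact_shiftBall (x : ℝ × ℝ) : IsCompact (shiftBall x) :=
  (Homeomorph.addLeft x).isCompact_preimage.mpr (isCompact_sq_le 1)

lemma measurableSet_shiftBall (x : ℝ × ℝ) : MeasurableSet (shiftBall x) :=
  (isCompact_shiftBall x).measurableSet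

lemma volume_real_shiftBall (x : ℝ × ℝ) :
    volume.real (shiftBall x) = volume.real {h : ℝ × ℝ | h.1 ^ 2 + h.2 ^ 2 ≤ 1} :=
  congrArg ENNReal.toReal (measure_preimage_add volume x {h : ℝ × ℝ | h.1 ^ 2 + h.2 ^ 2 ≤ 1})

lemma integrableOn_inv_rad {S : Set (ℝ × ℝ)} (hS : IsCompact S) :
    IntegrableOn (fun h => (rad h)⁻¹) S :=
  locallyIntegrable_inv_rad.integrableOn_isCompact hS

lemma exists_setIntegral_inv_rad_le :
    ∃ C, 0 ≤ C ∧ ∀ x, ∫ h in shiftBall x, (rad h)⁻¹ ≤ C := by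
  set B : Set (ℝ × ℝ) := {h | h.1 ^ 2 + h.2 ^ 2 ≤ 1} with hB
  have hBm : MeasurableSet B := (isClosed_sq_le 1).measurableSet
  have hpos : ∀ h, 0 ≤ (rad h)⁻¹ := fun h => inv_nonneg.mpr (rad_nonneg h)
  have hBi : Integrable (B.indicator fun h => (rad h)⁻¹) :=
    (integrable_indicator_iff hBm).mpr (integrableOn_inv_rad (isCompact_sq_le 1))
  have hind0 : ∀ h, 0 ≤ B.indicator (fun h => (rad h)⁻¹) h :=
    fun h => Set.indicator_nonneg (fun h _ => hpos h) h
  refine ⟨(∫ h in B, (rad h)⁻¹) + volume.real B,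
    add_nonneg (integral_nonneg hpos) measureReal_nonneg, fun x => ?_⟩
  have hone : IntegrableOn (fun _ : ℝ × ℝ => (1 : ℝ)) (shiftBall x) :=
    integrableOn_const (isCompact_shiftBall x).measure_lt_top.ne
  calc ∫ h in shiftBall x, (rad h)⁻¹
      ≤ ∫ h in shiftBall x, (B.indicator (fun h => (rad h)⁻¹) h + 1) := by
        refine setIntegral_mono (integrableOn_inv_rad (isCompact_shiftBall x))
          (hBi.integrableOn.add hone) fun h => ?_
        by_cases hh : h ∈ B
        · simp only [Set.indicator_of_mem hh]
          linarith
        · simp only [Set.indicator_of_notMem hh, zero_add]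
          rw [hB, Set.mem_ofPred_eq, ← rad_sq, not_le] at hh
          exact inv_le_one_of_one_le₀ (by nlinarith [rad_nonneg h])
    _ = (∫ h in shiftBall x, B.indicator (fun h => (rad h)⁻¹) h) + volume.real B := by
        rw [integral_add hBi.integrableOn hone, setIntegral_const, volume_real_shiftBall,
          smul_eq_mul, mul_one]
    _ ≤ _ := by
        rw [← integral_indicator hBm]
        exact add_le_add_left (setIntegral_le_integral hBi (Eventually.of_forall hind0)) _

lemma exists_abs_far_le {g : ℝ → ℝ} (hg : IsCutoff g) (K : ℕ) :
    ∃ C, 0 ≤ C ∧ ∀ N s a b Θ : ℝ, 0 < N → 0 < s → a ^ 2 + b ^ 2 = 1 → ∀ f : ℝ × ℝ → ℝ,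
      ContDiff ℝ K f → SuppBall f → ∀ x,
      |∫ h, s * farKer g (s • h) * f (x + h) * wave N a b Θ h|
        ≤ C * ∑ l ∈ Finset.range (K + 1), (N ^ K)⁻¹ * s ^ l * CkNorm (K - l) f := by
  obtain ⟨I, hI0, hI⟩ := exists_setIntegral_inv_rad_le
  choose D hD0 hD using exists_dirD_iterate_farKer_le hg
  set E : ℕ → ℝ := fun l => K.choose l * D l * 2 ^ (K - l) with hE
  have hE0 : ∀ l, 0 ≤ E l := fun l => by
    have := hD0 l
    positivity
  refine ⟨I * ∑ l ∈ Finset.range (K + 1), E l,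
    mul_nonneg hI0 (Finset.sum_nonneg fun l _ => hE0 l),
    fun N s a b Θ hN hs hab f hf hsf x => ?_⟩
  have hF : ContDiff ℝ K fun h => s * farKer g (s • h) :=
    contDiff_const.mul
      (((contDiff_farKer hg).of_le (by exact_mod_cast le_top)).comp (contDiff_const_smul s))
  have hfx : ContDiff ℝ K fun h => f (x + h) := hf.comp (contDiff_const.add contDiff_id)
  have hsupp : HasCompactSupport fun h => f (x + h) :=
    hsf.hasCompactSupport.comp_homeomorph (Homeomorph.addLeft x)
  refine (abs_integral_mul_wave_le (hF.mul hfx) hsupp.mul_left hN hab Θ).trans ?_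
  set M : ℝ := ∑ l ∈ Finset.range (K + 1), E l * (s ^ l * CkNorm (K - l) f) with hM
  have hM0 : 0 ≤ M := Finset.sum_nonneg fun l _ =>
    mul_nonneg (hE0 l) (mul_nonneg (pow_nonneg hs.le l) (CkNorm_nonneg _ _))
  have hpt : ∀ h, |(dirD (b, a))^[K] (fun h => s * farKer g (s • h) * f (x + h)) h|
      ≤ (shiftBall x).indicator (fun h => M * (rad h)⁻¹) h := by
    intro h
    rw [dirD_iterate_mul hF hfx]
    simp only [dirD_iterate_const_mul, dirD_iterate_comp_smul, dirD_iterate_comp_const_add]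
    by_cases hh : h ∈ shiftBall x
    · rw [Set.indicator_of_mem hh, hM, Finset.sum_mul]
      refine (Finset.abs_sum_le_sum_abs _ _).trans (Finset.sum_le_sum fun l hl => ?_)
      have hl' : l ≤ K := Nat.lt_succ_iff.mp (Finset.mem_range.mp hl)
      have hfl : ContDiff ℝ (K - l : ℕ) f := hf.of_le (by exact_mod_cast Nat.sub_le K l)
      have h1 := abs_dirD_iterate_le hfl (b, a) (x + h) (M := CkNorm (K - l) f)
        fun i j hij => abs_pdMix_le_CkNorm hfl hsf hij.le _
      rw [rad_eq_one hab, one_pow, mul_one] at h1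
      have h2 := hD l a b hab (s • h)
      rw [rad_smul hs.le, mul_inv] at h2
      have h3 := hD0 l
      have h4 := CkNorm_nonneg (K - l) f
      have h5 := inv_nonneg.mpr (rad_nonneg h)
      rw [abs_mul, abs_mul, abs_mul, abs_mul, abs_of_pos hs, abs_of_pos (pow_pos hs l),
        Nat.abs_cast]
      calc (K.choose l : ℝ) * (s * (s ^ l * |(dirD (b, a))^[l] (farKer g) (s • h)|))
            * |(dirD (b, a))^[K - l] f (x + h)|
          ≤ K.choose l * (s * (s ^ l * (D l * (s⁻¹ * (rad h)⁻¹))))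
            * (2 ^ (K - l) * CkNorm (K - l) f) := by gcongr
        _ = _ := by
          simp only [hE]
          field_simp
    · rw [Set.indicator_of_notMem hh]
      refine (abs_eq_zero.mpr (Finset.sum_eq_zero fun l _ => ?_)).le
      have : (dirD (b, a))^[K - l] f (x + h) = 0 := by
        by_contra h0
        exact hh (hsf.dirD_iterate (b, a) (K - l) _ h0)
      rw [this, mul_zero]
  have hint : ∫ h, |(dirD (b, a))^[K] (fun h => s * farKer g (s • h) * f (x + h)) h|
      ≤ M * I := by
    refine (integral_mono_of_nonneg (Eventually.of_forall fun h => abs_nonneg _)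
      ((integrable_indicator_iff (measurableSet_shiftBall x)).mpr
        ((integrableOn_inv_rad (isCompact_shiftBall x)).const_mul M))
      (Eventually.of_forall hpt)).trans ?_
    rw [integral_indicator (measurableSet_shiftBall x), integral_const_mul]
    exact mul_le_mul_of_nonneg_left (hI x) hM0
  have hMle : M ≤ (∑ l ∈ Finset.range (K + 1), E l)
      * ∑ l ∈ Finset.range (K + 1), s ^ l * CkNorm (K - l) f := by
    have h0 : ∀ l, 0 ≤ s ^ l * CkNorm (K - l) f :=
      fun l => mul_nonneg (pow_nonneg hs.le l) (CkNorm_nonneg _ _)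
    rw [hM, Finset.mul_sum]
    exact Finset.sum_le_sum fun l hl => mul_le_mul_of_nonneg_right
      (Finset.single_le_sum (fun l _ => hE0 l) hl) (h0 l)
  calc (N ^ K)⁻¹ * ∫ h, |(dirD (b, a))^[K] (fun h => s * farKer g (s • h) * f (x + h)) h|
      ≤ (N ^ K)⁻¹ * (((∑ l ∈ Finset.range (K + 1), E l)
          * ∑ l ∈ Finset.range (K + 1), s ^ l * CkNorm (K - l) f) * I) := by
        gcongr
        exact hint.trans (by gcongr)
    _ = _ := by
        simp only [mul_assoc, ← Finset.mul_sum]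
        ring

lemma IsCutoff.abs_le_one {g : ℝ → ℝ} (hg : IsCutoff g) (r : ℝ) : |g r| ≤ 1 := by
  rcases le_or_gt r (1 / 2) with h | h
  · rw [hg.2.2.1 r h, abs_one]
  rcases le_or_gt 1 r with h1 | h1
  · rw [hg.2.2.2 r h1, abs_zero]
    exact zero_le_one
  have h2 := hg.2.1 (Set.mem_Ici.mpr le_rfl) (Set.mem_Ici.mpr (by linarith)) (by linarith : 0 ≤ r)
  have h3 := hg.2.1 (Set.mem_Ici.mpr (by linarith)) (Set.mem_Ici.mpr zero_le_one) h1.le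
  rw [hg.2.2.1 0 (by norm_num)] at h2
  rw [hg.2.2.2 1 le_rfl] at h3
  exact abs_le.mpr ⟨by linarith, h2⟩

lemma abs_integral_near_le {g : ℝ → ℝ} (hg : IsCutoff g) {K : ℕ} {s M : ℝ} (hs : 0 < s)
    {R w : ℝ × ℝ → ℝ} (hR : ∀ h, |R h| ≤ M * rad h ^ (K + 1)) (hw : ∀ h, |w h| ≤ 1) :
    |∫ h, kerV h * (R h * w h * g (s * rad h))| ≤ 4 * M * (s ^ (K + 2))⁻¹ := by
  have hM : 0 ≤ M := by
    have h1 := (abs_nonneg _).trans (hR (1, 0))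
    rwa [show rad (1, 0) = 1 by simp [rad], one_pow, mul_one] at h1
  have hsi : 0 < s⁻¹ := inv_pos.mpr hs
  set S : Set (ℝ × ℝ) := Set.Icc (-s⁻¹, -s⁻¹) (s⁻¹, s⁻¹) with hS
  have hSv : volume.real S = 4 * (s⁻¹) ^ 2 := by
    rw [hS, ← Set.Icc_prod_Icc, Measure.volume_eq_prod, measureReal_prod_prod,
      Real.volume_real_Icc_of_le (by linarith)]
    ring
  have hSf : volume S < ⊤ := isCompact_Icc.measure_lt_top
  have hpt : ∀ h, |kerV h * (R h * w h * g (s * rad h))| ≤ M * (s⁻¹) ^ K := by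
    intro h
    rcases le_or_gt (rad h) s⁻¹ with hr | hr
    · have hr0 := rad_nonneg h
      rw [abs_mul, abs_mul, abs_mul]
      calc |kerV h| * (|R h| * |w h| * |g (s * rad h)|)
          ≤ (rad h)⁻¹ * (M * rad h ^ (K + 1) * 1 * 1) := by
            have h0 := inv_nonneg.mpr hr0
            gcongr
            · exact abs_kerV_le h
            · exact hR h
            · exact hw h
            · exact hg.abs_le_one _
        _ ≤ M * rad h ^ K := by
            rcases hr0.eq_or_lt with h0 | h0
            · rw [← h0, inv_zero, zero_mul]
              positivity
            · rw [pow_succ]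
              field_simp
              exact le_rfl
        _ ≤ _ := by gcongr
    · have : 1 ≤ s * rad h := by
        rw [← mul_inv_cancel₀ hs.ne']
        gcongr
      rw [hg.2.2.2 _ this, mul_zero, mul_zero, abs_zero]
      positivity
  have hz : ∀ h, h ∉ S → kerV h * (R h * w h * g (s * rad h)) = 0 := by
    intro h hh
    have : s⁻¹ < rad h := by
      by_contra hr
      rw [not_lt] at hr
      have h1 := abs_le.mp ((abs_fst_le_rad h).trans hr)
      have h2 := abs_le.mp ((abs_snd_le_rad h).trans hr)
      exact hh ⟨⟨h1.1, h2.1⟩, ⟨h1.2, h2.2⟩⟩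
    have : 1 ≤ s * rad h := by
      rw [← mul_inv_cancel₀ hs.ne']
      gcongr
    rw [hg.2.2.2 _ this, mul_zero, mul_zero]
  rw [← setIntegral_eq_integral_of_forall_compl_eq_zero hz, ← Real.norm_eq_abs]
  refine (norm_setIntegral_le_of_norm_le_const hSf fun h _ => hpt h).trans (le_of_eq ?_)
  rw [hSv, inv_pow, inv_pow, pow_add]
  field_simp

lemma integral_taylorMono_wave_eq {g : ℝ → ℝ} {i j : ℕ} (hj : j ≤ i) {N s : ℝ} (hN : 0 < N)
    (a b Θ : ℝ) :
    ∫ h, kerV h * (taylorMono i j h * wave N a b Θ h * g (N * s * rad h))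
      = (N ^ (i + 1))⁻¹ * moment g a b i j Θ s := by
  have hpt : ∀ h, kerV h * (taylorMono i j h * wave N a b Θ h * g (N * s * rad h))
      = N * (N ^ i)⁻¹ * (fun k => kerV k * (taylorMono i j k * wave 1 a b Θ k * g (s * rad k)))
        (N • h) := by
    intro h
    have hw : wave 1 a b Θ (N • h) = wave N a b Θ h := by
      simp only [wave, Prod.smul_fst, Prod.smul_snd, smul_eq_mul]
      congr 1
      ring
    simp only []
    rw [kerV_smul hN.ne', taylorMono_smul hj, hw, rad_smul hN.le,
      show s * (N * rad h) = N * s * rad h by ring]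
    field_simp
  rw [integral_congr_ae (Eventually.of_forall hpt), integral_const_mul,
    Measure.integral_comp_smul volume
      (fun k => kerV k * (taylorMono i j k * wave 1 a b Θ k * g (s * rad k)))]
  simp only [Module.finrank_prod, Module.finrank_self, smul_eq_mul]
  rw [abs_of_pos (by positivity : 0 < (N ^ (1 + 1))⁻¹), ← mul_assoc, moment]
  congr 1
  field_simp
  ring

lemma moment_eq {g : ℝ → ℝ} (hg : IsCutoff g) (a b : ℝ) (i j : ℕ) (Θ : ℝ) {s : ℝ} (hs : 0 < s) :
    moment g a b i j Θ s
      = Real.sin Θ * moment g a b i j (π / 2) s + Real.cos Θ * moment g a b i j 0 s := by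
  have hφ : ∀ Θ, Continuous fun h => taylorMono i j h * wave 1 a b Θ h := fun Θ =>
    (contDiff_taylorMono (n := 0) i j).continuous.mul
      (contDiff_wave (n := 0) 1 a b Θ).continuous
  rw [moment, moment, moment, ← integral_const_mul, ← integral_const_mul,
    ← integral_add ((integrable_kerV_mul_cutoff hg hs (hφ _)).const_mul _)
      ((integrable_kerV_mul_cutoff hg hs (hφ _)).const_mul _)]
  refine integral_congr_ae (Eventually.of_forall fun h => ?_)
  simp only [wave, Real.sin_add, Real.sin_pi_div_two, Real.cos_pi_div_two, Real.sin_zero,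
    Real.cos_zero]
  ring

lemma inv_pow_mul_rpow_le {N ε : ℝ} (hN : 1 ≤ N) {K i : ℕ} (hi : i ≤ K) (hε : ε ≤ 1) :
    (N ^ (i + 1))⁻¹ * (N ^ (ε - 1)) ^ (K + 1)
      ≤ N ^ (((K - i : ℕ) : ℝ) * ε + ((0 : ℕ) : ℝ) - (K : ℝ)) := by
  have hN0 : 0 < N := by linarith
  rw [← Real.rpow_natCast, ← Real.rpow_neg hN0.le, ← Real.rpow_mul_natCast hN0.le,
    ← Real.rpow_add hN0]
  refine Real.rpow_le_rpow_of_exponent_le hN ?_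
  push_cast [Nat.cast_sub hi]
  have : 0 ≤ ((i : ℝ) + 1) * (1 - ε) := mul_nonneg (by positivity) (by linarith)
  linarith

/-- The uniform bound for the approximation error. -/
lemma exists_abs_Verr_le {g : ℝ → ℝ} (hg : IsCutoff g) (K : ℕ) {ε : ℝ}
    (hε : ε ∈ Set.Ioo (0 : ℝ) 1) :
    ∃ C, 0 ≤ C ∧ ∀ N a b : ℝ, 1 ≤ N → a ^ 2 + b ^ 2 = 1 → ∀ cs cc : ℕ → ℕ → ℝ,
      (∀ i j : ℕ, j ≤ i → i ≤ K →
        Tendsto (fun M : ℝ => Tijs g ε a b i j M) atTop (nhds (cs i j)) ∧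
        Tendsto (fun M : ℝ => Tijc g ε a b i j M) atTop (nhds (cc i j))) →
      ∀ (Θ : ℝ) (f : ℝ × ℝ → ℝ), ContDiff ℝ (K + 2 : ℕ) f → SuppBall f →
        ∀ x, |Verr cs cc K N a b Θ f x| ≤ C * errBound K ε N 0 f := by
  obtain ⟨A, hA0, hA⟩ := exists_abs_far_le hg K
  have hD : ∀ i j : ℕ, ∃ C, 0 ≤ C ∧ (j ≤ i → ∀ a b : ℝ, a ^ 2 + b ^ 2 = 1 → ∀ Θ N c : ℝ,
      1 ≤ N → Tendsto (fun M : ℝ => moment g a b i j Θ (M ^ (ε - 1))) atTop (nhds c) →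
      |moment g a b i j Θ (N ^ (ε - 1)) - c| ≤ C * (N ^ (ε - 1)) ^ (K + 1)) := fun i j => by
    by_cases hj : j ≤ i
    · obtain ⟨C, hC0, hC⟩ := exists_abs_moment_sub_limit_le hg hj hε.2 (Nat.succ_pos K)
      exact ⟨C, hC0, fun _ => hC⟩
    · exact ⟨0, le_rfl, fun h => absurd h hj⟩
  choose D hD0 hD using hD
  set B : ℝ := ∑ i ∈ Finset.range (K + 1), ∑ j ∈ Finset.range (i + 1), 2 * D i j with hB
  have hBi0 : ∀ i, 0 ≤ ∑ j ∈ Finset.range (i + 1), 2 * D i j :=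
    fun i => Finset.sum_nonneg fun j _ => mul_nonneg zero_le_two (hD0 i j)
  have hB0 : 0 ≤ B := Finset.sum_nonneg fun i _ => hBi0 i
  refine ⟨A + B + 4 * 2 ^ (K + 1), by positivity,
    fun N a b hN hab cs cc hlim Θ f hf hsf x => ?_⟩
  have hN0 : 0 < N := by linarith
  set s : ℝ := N ^ ε with hs
  have hs0 : 0 < s := Real.rpow_pos_of_pos hN0 ε
  have hsN : N * N ^ (ε - 1) = s := by
    rw [Real.rpow_sub_one hN0.ne', hs]
    field_simp
  set P : ℝ := N * (b * x.1 + a * x.2) + Θ with hP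
  set S₁ : ℝ := ∑ i ∈ Finset.range (K + 1),
    N ^ ((i : ℝ) * ε + ((0 : ℕ) : ℝ) - (K : ℝ)) * CkNorm (K - i) f with hS₁
  set S₂ : ℝ := N ^ (((0 : ℕ) : ℝ) - ((K : ℝ) + 2) * ε) * CkNorm (K + 1) f with hS₂
  have hS₁0 : 0 ≤ S₁ := Finset.sum_nonneg fun i _ =>
    mul_nonneg (Real.rpow_nonneg hN0.le _) (CkNorm_nonneg _ _)
  have hS₂0 : 0 ≤ S₂ := mul_nonneg (Real.rpow_nonneg hN0.le _) (CkNorm_nonneg _ _)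
  have herr : errBound K ε N 0 f = S₁ + S₂ := rfl
  set T : ℝ × ℝ → ℝ := fun h => ∑ i ∈ Finset.range (K + 1), ∑ j ∈ Finset.range (i + 1),
    pdMix (i - j) j f x * taylorMono i j h with hT
  have hTc : Continuous T := continuous_finsetSum _ fun i _ => continuous_finsetSum _ fun j _ =>
    continuous_const.mul (contDiff_taylorMono (n := 0) i j).continuous
  have hwc : Continuous (wave N a b P) := (contDiff_wave (n := 0) N a b P).continuous
  have hfx : Continuous fun h => f (x + h) :=
    hf.continuous.comp (continuous_const.add continuous_id)
  have hfs : HasCompactSupport fun h => f (x + h) :=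
    hsf.hasCompactSupport.comp_homeomorph (Homeomorph.addLeft x)
  have hfar : ∀ h, s * farKer g (s • h) = kerV h * (1 - g (s * rad h)) := fun h => by
    rw [farKer, kerV_smul hs0.ne', rad_smul hs0.le]
    field_simp
  have hi₁ : Integrable fun h => s * farKer g (s • h) * f (x + h) * wave N a b P h := by
    have hc : Continuous fun h => f (x + h) * (wave N a b P h * (1 - g (s * rad h))) :=
      hfx.mul (hwc.mul (continuous_const.sub (continuous_cutoff hg s)))
    refine (integrable_kerV_mul hc hfs.mul_right).congr (Eventually.of_forall fun h => ?_)
    simp only []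
    rw [hfar]
    ring
  have hi₂ : Integrable fun h =>
      kerV h * ((f (x + h) - T h) * wave N a b P h * g (s * rad h)) :=
    integrable_kerV_mul_cutoff hg hs0 ((hfx.sub hTc).mul hwc)
  have hi₁₂ : Integrable fun h => s * farKer g (s • h) * f (x + h) * wave N a b P h
      + kerV h * ((f (x + h) - T h) * wave N a b P h * g (s * rad h)) := hi₁.add hi₂
  have hi₃ : ∀ i j, Integrable fun h =>
      kerV h * (taylorMono i j h * wave N a b P h * g (s * rad h)) := fun i j =>
    integrable_kerV_mul_cutoff hg hs0 ((contDiff_taylorMono (n := 0) i j).continuous.mul hwc)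
  have hi₃' : ∀ i ∈ Finset.range (K + 1), Integrable fun h => ∑ j ∈ Finset.range (i + 1),
      pdMix (i - j) j f x * (kerV h * (taylorMono i j h * wave N a b P h * g (s * rad h))) :=
    fun i _ => integrable_finsetSum _ fun j _ => (hi₃ i j).const_mul _
  have hV : Vop (fun y => f y * wave N a b Θ y) x
      = (∫ h, s * farKer g (s • h) * f (x + h) * wave N a b P h)
        + (∫ h, kerV h * ((f (x + h) - T h) * wave N a b P h * g (s * rad h)))
        + ∑ i ∈ Finset.range (K + 1), ∑ j ∈ Finset.range (i + 1),
          pdMix (i - j) j f x * ((N ^ (i + 1))⁻¹ * moment g a b i j P (N ^ (ε - 1))) := by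
    have hm : ∑ i ∈ Finset.range (K + 1), ∑ j ∈ Finset.range (i + 1),
          pdMix (i - j) j f x * ((N ^ (i + 1))⁻¹ * moment g a b i j P (N ^ (ε - 1)))
        = ∫ h, ∑ i ∈ Finset.range (K + 1), ∑ j ∈ Finset.range (i + 1), pdMix (i - j) j f x *
          (kerV h * (taylorMono i j h * wave N a b P h * g (s * rad h))) := by
      rw [integral_finsetSum _ hi₃']
      refine Finset.sum_congr rfl fun i _ => ?_
      rw [integral_finsetSum _ fun j _ => (hi₃ i j).const_mul _]
      refine Finset.sum_congr rfl fun j hj => ?_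
      rw [integral_const_mul, ← integral_taylorMono_wave_eq
        (Nat.lt_succ_iff.mp (Finset.mem_range.mp hj)) hN0, hsN]
    rw [hm, ← integral_add hi₁ hi₂,
      ← integral_add hi₁₂ (integrable_finsetSum _ hi₃'), Vop]
    refine integral_congr_ae (Eventually.of_forall fun h => ?_)
    have hw : wave N a b Θ (x + h) = wave N a b P h := by
      simp only [wave, Prod.fst_add, Prod.snd_add, hP]
      congr 1
      ring
    have hTs : ∑ i ∈ Finset.range (K + 1), ∑ j ∈ Finset.range (i + 1), pdMix (i - j) j f x *
          (kerV h * (taylorMono i j h * wave N a b P h * g (s * rad h)))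
        = kerV h * (T h * wave N a b P h * g (s * rad h)) := by
      simp only [hT, Finset.sum_mul, Finset.mul_sum]
      refine Finset.sum_congr rfl fun i _ => Finset.sum_congr rfl fun j _ => ?_
      ring
    simp only []
    rw [hTs, hfar, hw, ← kerV]
    ring
  have hb₁ : |∫ h, s * farKer g (s • h) * f (x + h) * wave N a b P h| ≤ A * S₁ := by
    refine (hA N s a b P hN0 hs0 hab f (hf.of_le (by norm_cast; omega)) hsf x).trans (le_of_eq ?_)
    rw [hS₁]
    congr 1
    refine Finset.sum_congr rfl fun l _ => ?_
    rw [Nat.cast_zero, add_zero, Real.rpow_sub hN0, Real.rpow_natCast, mul_comm (l : ℝ) ε,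
      Real.rpow_mul hN0.le, Real.rpow_natCast]
    ring
  have hb₂ : |∫ h, kerV h * ((f (x + h) - T h) * wave N a b P h * g (s * rad h))|
      ≤ 4 * 2 ^ (K + 1) * S₂ := by
    refine (abs_integral_near_le hg hs0
      (abs_sub_taylor_le (hf.of_le (by norm_cast; omega)) hsf x)
      (abs_wave_le_one N a b P)).trans (le_of_eq ?_)
    rw [hS₂, Nat.cast_zero, zero_sub, Real.rpow_neg hN0.le, mul_comm ((K : ℝ) + 2) ε,
      Real.rpow_mul hN0.le, show (K : ℝ) + 2 = (K + 2 : ℕ) by push_cast; ring, Real.rpow_natCast]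
    ring
  have hb₃ : |∑ i ∈ Finset.range (K + 1), ∑ j ∈ Finset.range (i + 1),
        pdMix (i - j) j f x * ((N ^ (i + 1))⁻¹ * moment g a b i j P (N ^ (ε - 1)))
      - VKapprox cs cc K N a b Θ f x| ≤ B * S₁ := by
    rw [VKapprox, ← Finset.sum_sub_distrib]
    have hterm : ∀ i ∈ Finset.range (K + 1), |∑ j ∈ Finset.range (i + 1),
        pdMix (i - j) j f x * ((N ^ (i + 1))⁻¹ * moment g a b i j P (N ^ (ε - 1)))
        - ∑ j ∈ Finset.range (i + 1), pdMix (i - j) j f x / N ^ (i + 1) *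
          (cs i j * Real.sin P + cc i j * Real.cos P)|
        ≤ (∑ j ∈ Finset.range (i + 1), 2 * D i j) * S₁ := by
      intro i hi
      have hi' : i ≤ K := Nat.lt_succ_iff.mp (Finset.mem_range.mp hi)
      have hfi : ContDiff ℝ i f := hf.of_le (by norm_cast; omega)
      rw [← Finset.sum_sub_distrib, Finset.sum_mul]
      refine (Finset.abs_sum_le_sum_abs _ _).trans (Finset.sum_le_sum fun j hj => ?_)
      have hj' : j ≤ i := Nat.lt_succ_iff.mp (Finset.mem_range.mp hj)
      obtain ⟨hls, hlc⟩ := hlim i j hj' hi'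
      simp only [Tijs_eq_moment, Tijc_eq_moment] at hls hlc
      have h1 := hD i j hj' a b hab _ N _ hN hls
      have h2 := hD i j hj' a b hab _ N _ hN hlc
      have h3 : |pdMix (i - j) j f x| ≤ CkNorm i f :=
        abs_pdMix_le_CkNorm hfi hsf (Nat.sub_add_cancel hj').le x
      set m₁ := moment g a b i j (π / 2) (N ^ (ε - 1)) - cs i j with hm₁
      set m₂ := moment g a b i j 0 (N ^ (ε - 1)) - cc i j with hm₂
      have e : pdMix (i - j) j f x * ((N ^ (i + 1))⁻¹ * moment g a b i j P (N ^ (ε - 1)))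
          - pdMix (i - j) j f x / N ^ (i + 1) * (cs i j * Real.sin P + cc i j * Real.cos P)
          = pdMix (i - j) j f x * (N ^ (i + 1))⁻¹ * (Real.sin P * m₁ + Real.cos P * m₂) := by
        rw [moment_eq hg a b i j P (Real.rpow_pos_of_pos hN0 _), hm₁, hm₂]
        ring
      have h4 : |Real.sin P * m₁ + Real.cos P * m₂| ≤ 2 * D i j * (N ^ (ε - 1)) ^ (K + 1) := by
        refine (abs_add_le _ _).trans ?_
        rw [abs_mul, abs_mul]
        have h5 := mul_le_of_le_one_left (abs_nonneg m₁) (Real.abs_sin_le_one P)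
        have h6 := mul_le_of_le_one_left (abs_nonneg m₂) (Real.abs_cos_le_one P)
        linarith
      have h7 := hD0 i j
      have h8 : N ^ (((K - i : ℕ) : ℝ) * ε + ((0 : ℕ) : ℝ) - (K : ℝ)) * CkNorm (K - (K - i)) f
          ≤ S₁ :=
        Finset.single_le_sum (f := fun i : ℕ =>
          N ^ ((i : ℝ) * ε + ((0 : ℕ) : ℝ) - (K : ℝ)) * CkNorm (K - i) f)
          (fun l _ => mul_nonneg (Real.rpow_nonneg hN0.le _) (CkNorm_nonneg _ _))
          (Finset.mem_range.mpr (by omega))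
      rw [Nat.sub_sub_self hi'] at h8
      have h9 := CkNorm_nonneg i f
      rw [e, abs_mul, abs_mul, abs_of_pos (by positivity : 0 < (N ^ (i + 1))⁻¹)]
      calc |pdMix (i - j) j f x| * (N ^ (i + 1))⁻¹ * |Real.sin P * m₁ + Real.cos P * m₂|
          ≤ CkNorm i f * (N ^ (i + 1))⁻¹ * (2 * D i j * (N ^ (ε - 1)) ^ (K + 1)) := by gcongr
        _ = 2 * D i j * ((N ^ (i + 1))⁻¹ * (N ^ (ε - 1)) ^ (K + 1) * CkNorm i f) := by ring
        _ ≤ 2 * D i j * S₁ := by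
          gcongr
          refine le_trans ?_ h8
          gcongr
          exact inv_pow_mul_rpow_le hN hi' hε.2.le
    rw [hB, Finset.sum_mul]
    exact (Finset.abs_sum_le_sum_abs _ _).trans (Finset.sum_le_sum hterm)
  rw [Verr, hV, herr, add_sub_assoc]
  refine (abs_add_three _ _ _).trans ?_
  have h1 : 0 ≤ (A + B) * S₂ := by positivity
  have h2 : 0 ≤ (4 * 2 ^ (K + 1)) * S₁ := by positivity
  linarith

/-- Local approximation of the operator `V` by `V^K`. -/
theorem V_local_approximation (g : ℝ → ℝ) (hg : IsCutoff g)
    (K : ℕ) (ε : ℝ) (hε : ε ∈ Set.Ioo (0 : ℝ) 1) (J : ℕ) :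
    ∃ C > 0, ∀ N : ℝ, 1 ≤ N → ∀ a b Θ₀ : ℝ, a ^ 2 + b ^ 2 = 1 →
      ∀ cs cc : ℕ → ℕ → ℝ,
        (∀ i j : ℕ, j ≤ i → i ≤ K →
          Tendsto (fun M : ℝ => Tijs g ε a b i j M) atTop (nhds (cs i j)) ∧
          Tendsto (fun M : ℝ => Tijc g ε a b i j M) atTop (nhds (cc i j))) →
      ∀ f : ℝ × ℝ → ℝ, ContDiff ℝ (K + J + 2 : ℕ) f →
        (∀ x : ℝ × ℝ, f x ≠ 0 → x.1 ^ 2 + x.2 ^ 2 < 1) →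
        CkNorm J (fun x : ℝ × ℝ =>
            Vop (fun y => f y * Real.sin (N * (b * y.1 + a * y.2) + Θ₀)) x
              - VKapprox cs cc K N a b Θ₀ f x)
          ≤ C * ((∑ i ∈ Finset.range (K + 1),
                N ^ ((i : ℝ) * ε + (J : ℝ) - (K : ℝ)) * CkNorm (K - i + J) f)
              + N ^ ((J : ℝ) - ((K : ℝ) + 2) * ε) * CkNorm (K + J + 1) f) := by
  obtain ⟨C, hC0, hC⟩ := exists_abs_Verr_le hg K hε
  refine ⟨2 ^ J * C + 1, by positivity, fun N hN a b Θ₀ hab cs cc hlim f hf hsupp => ?_⟩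
  have hs : SuppBall f := fun x hx => (hsupp x hx).le
  have h0 : 0 ≤ errBound K ε N J f := errBound_nonneg K J (by linarith) f
  change CkNorm J (Verr cs cc K N a b Θ₀ f) ≤ (2 ^ J * C + 1) * errBound K ε N J f
  refine CkNorm_le fun i j x hij => ?_
  have hf' : ContDiff ℝ (K + (i + j) + 2 : ℕ) f := hf.of_le (by norm_cast; omega)
  calc |pdMix i j (Verr cs cc K N a b Θ₀ f) x|
      ≤ 2 ^ (i + j) * C * errBound K ε N (i + j) f :=
        abs_pdMix_Verr_le hN hab (hC N a b hN hab cs cc hlim) hC0 hf' hs Θ₀ rfl x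
    _ ≤ 2 ^ J * C * errBound K ε N J f :=
        mul_le_mul (mul_le_mul_of_nonneg_right (pow_le_pow_right₀ one_le_two hij) hC0)
          (errBound_mono hN hf hs hij) (errBound_nonneg K (i + j) (by linarith) f) (by positivity)
    _ ≤ _ := by linarith
end

section
/- Positivity of the limiting constant: for every ε ∈ (0,1), the limit lim_{N→∞} ∫_{ℝ²} (h₁/|h|²) sin(h₁ + h₂) g(N^{ε−1}|h|) dh₁ dh₂ exists and is strictly positive. -/
open MeasureTheory Real Filter

/-- The integral over a disc in polar coordinates, with the angular integral outermost. -/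
theorem integral_cutoff_eq_polar {g : ℝ → ℝ} (hgc : Continuous g)
    (hg1 : ∀ r : ℝ, 1 ≤ r → g r = 0) {d : ℝ} (hd : 0 < d) :
    ∫ h : ℝ × ℝ, (h.1 / (h.1 ^ 2 + h.2 ^ 2)) * Real.sin (h.1 + h.2) * g (d * rad h) =
      ∫ θ in (-π)..π, cos θ * ∫ r in (0 : ℝ)..d⁻¹, g (d * r) * sin ((cos θ + sin θ) * r) := by
  rw [← integral_comp_polarCoord_symm, polarCoord_target]
  have hpi : -π ≤ π := by linarith [pi_pos]
  have hd' : 0 ≤ d⁻¹ := by positivity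
  calc _ = ∫ p in Set.Ioi 0 ×ˢ Set.Ioo (-π) π,
          cos p.2 * (g (d * p.1) * sin ((cos p.2 + sin p.2) * p.1)) := by
        refine setIntegral_congr_fun (measurableSet_Ioi.prod measurableSet_Ioo) ?_
        rintro ⟨r, θ⟩ ⟨hr, -⟩
        have hr : 0 < r := hr
        have hsq : (r * cos θ) ^ 2 + (r * sin θ) ^ 2 = r ^ 2 := by
          linear_combination r ^ 2 * cos_sq_add_sin_sq θ
        simp only [polarCoord_symm_apply, rad, hsq, sqrt_sq hr.le, smul_eq_mul]
        rw [show r * cos θ + r * sin θ = (cos θ + sin θ) * r by ring]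
        field_simp
    _ = ∫ p in Set.Ioc 0 d⁻¹ ×ˢ Set.Ioo (-π) π,
          cos p.2 * (g (d * p.1) * sin ((cos p.2 + sin p.2) * p.1)) := by
        refine setIntegral_eq_of_subset_of_forall_sdiff_eq_zero
          (measurableSet_Ioi.prod measurableSet_Ioo)
          (Set.prod_mono Set.Ioc_subset_Ioi_self subset_rfl) ?_
        rintro ⟨r, θ⟩ ⟨⟨hr, hθ⟩, hn⟩
        have hr : 0 < r := hr
        have hlt : d⁻¹ < r := by
          by_contra! hle
          exact hn ⟨⟨hr, hle⟩, hθ⟩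
        have : g (d * r) = 0 := hg1 _ ((inv_le_iff_one_le_mul₀' hd).1 hlt.le)
        simp [this]
    _ = ∫ p in Set.Ioo (-π) π ×ˢ Set.Ioc 0 d⁻¹,
          cos p.1 * (g (d * p.2) * sin ((cos p.1 + sin p.1) * p.2)) :=
        (setIntegral_prod_swap (μ := volume) (ν := volume) (Set.Ioc 0 d⁻¹) (Set.Ioo (-π) π)
          fun p : ℝ × ℝ => cos p.2 * (g (d * p.1) * sin ((cos p.2 + sin p.2) * p.1))).symm
    _ = _ := by
        rw [Measure.volume_eq_prod, setIntegral_prod, intervalIntegral.integral_of_le hpi,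
          integral_Ioc_eq_integral_Ioo]
        · simp only [intervalIntegral.integral_of_le hd', integral_const_mul]
        · have hc : Continuous fun p : ℝ × ℝ =>
              cos p.1 * (g (d * p.2) * sin ((cos p.1 + sin p.1) * p.2)) := by fun_prop
          exact (hc.continuousOn.integrableOn_compact
            (isCompact_Icc.prod isCompact_Icc)).mono_set
              (Set.prod_mono Set.Ioo_subset_Icc_self Set.Ioc_subset_Icc_self)

/-- Reflecting `θ` to `π / 2 - θ` averages `cos θ` and `sin θ`. -/
theorem integral_cos_mul_comp_cos_add_sin {Ψ : ℝ → ℝ} (hΨ : Continuous Ψ) :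
    ∫ θ in (-π)..π, cos θ * Ψ (cos θ + sin θ) =
      (1 / 2) * ∫ θ in (-π)..π, (cos θ + sin θ) * Ψ (cos θ + sin θ) := by
  have hper : Function.Periodic (fun θ => sin θ * Ψ (cos θ + sin θ)) (2 * π) := fun θ => by
    simp only [sin_add_two_pi, cos_add_two_pi]
  have hsymm : ∫ θ in (-π)..π, cos θ * Ψ (cos θ + sin θ) =
      ∫ θ in (-π)..π, sin θ * Ψ (cos θ + sin θ) := by
    have h := intervalIntegral.integral_comp_sub_left (a := -π) (b := π)
      (fun θ => sin θ * Ψ (cos θ + sin θ)) (π / 2)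
    simp only [sin_pi_div_two_sub, cos_pi_div_two_sub] at h
    have h2 := hper.intervalIntegral_add_eq (π / 2 - π) (-π)
    rw [show π / 2 - π + 2 * π = π / 2 - -π by ring, show -π + 2 * π = π by ring] at h2
    rw [← h2, ← h]
    simp only [add_comm]
  have hadd : ∫ θ in (-π)..π, (cos θ + sin θ) * Ψ (cos θ + sin θ) =
      (∫ θ in (-π)..π, cos θ * Ψ (cos θ + sin θ)) +
        ∫ θ in (-π)..π, sin θ * Ψ (cos θ + sin θ) := by
    simp only [add_mul]
    exact intervalIntegral.integral_add
      (Continuous.intervalIntegrable (by fun_prop) _ _)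
      (Continuous.intervalIntegrable (by fun_prop) _ _)
  rw [hadd, ← hsymm]
  ring

theorem mul_integral_cutoff_mul_sin {g : ℝ → ℝ} (hg : ContDiff ℝ 1 g) (hg0 : g 0 = 1)
    (hg1 : g 1 = 0) {d : ℝ} (hd : 0 < d) (c : ℝ) :
    c * ∫ r in (0 : ℝ)..d⁻¹, g (d * r) * sin (c * r) =
      1 + ∫ s in (0 : ℝ)..1, deriv g s * cos (c * d⁻¹ * s) := by
  have hdg : Continuous (deriv g) := hg.continuous_deriv_one
  have hgc : Continuous g := hg.continuous
  have hsub : c * ∫ r in (0 : ℝ)..d⁻¹, g (d * r) * sin (c * r) =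
      ∫ s in (0 : ℝ)..1, g s * (c * d⁻¹ * sin (c * d⁻¹ * s)) := by
    have h := intervalIntegral.integral_comp_mul_left (a := 0) (b := d⁻¹)
      (fun s => g s * (c * d⁻¹ * sin (c * d⁻¹ * s))) hd.ne'
    rw [mul_zero, mul_inv_cancel₀ hd.ne'] at h
    rw [← intervalIntegral.integral_const_mul]
    rw [smul_eq_mul, eq_comm, inv_mul_eq_iff_eq_mul₀ hd.ne',
      ← intervalIntegral.integral_const_mul] at h
    rw [h]
    refine intervalIntegral.integral_congr fun r _ => ?_
    rw [show c * d⁻¹ * (d * r) = c * r by field_simp]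
    field_simp
  rw [hsub, intervalIntegral.integral_mul_deriv_eq_deriv_mul
    (u' := deriv g) (v := fun s => -cos (c * d⁻¹ * s))]
  · simp [hg0, hg1]
  · exact fun x _ => (hg.differentiable one_ne_zero x).hasDerivAt
  · intro x _
    have h := ((hasDerivAt_id x).const_mul (c * d⁻¹)).cos.neg
    simpa [mul_comm, Pi.neg_def] using h
  · exact hdg.intervalIntegrable _ _
  · exact Continuous.intervalIntegrable (by fun_prop) _ _

theorem abs_integral_mul_cos_le {u : ℝ → ℝ} (hu : ContDiff ℝ 1 u) :
    ∃ C, ∀ w : ℝ, |w * ∫ s in (0 : ℝ)..1, u s * cos (w * s)| ≤ C := by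
  have hdu : Continuous (deriv u) := hu.continuous_deriv_one
  refine ⟨|u 1| + ∫ s in (0 : ℝ)..1, |deriv u s|, fun w => ?_⟩
  have hparts : w * ∫ s in (0 : ℝ)..1, u s * cos (w * s) =
      u 1 * sin w - ∫ s in (0 : ℝ)..1, deriv u s * sin (w * s) := by
    rw [← intervalIntegral.integral_const_mul]
    have h := intervalIntegral.integral_mul_deriv_eq_deriv_mul (a := 0) (b := 1) (u := u)
      (u' := deriv u) (v := fun s => sin (w * s)) (v' := fun s => w * cos (w * s))
      (fun x _ => (hu.differentiable one_ne_zero x).hasDerivAt)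
      (fun x _ => by
        simpa [mul_comm] using ((hasDerivAt_id x).const_mul w).sin)
      (hdu.intervalIntegrable _ _)
      (Continuous.intervalIntegrable (by fun_prop) _ _)
    simp only [mul_one, mul_zero, sin_zero, sub_zero] at h
    rw [← h]
    exact intervalIntegral.integral_congr fun s _ => by ring
  rw [hparts]
  refine (abs_sub _ _).trans (add_le_add ?_ ?_)
  · rw [abs_mul]
    exact mul_le_of_le_one_right (abs_nonneg _) (abs_sin_le_one _)
  · refine (intervalIntegral.abs_integral_le_integral_abs zero_le_one).trans
      (intervalIntegral.integral_mono_on zero_le_one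
        (Continuous.intervalIntegrable (by fun_prop) _ _)
        (Continuous.intervalIntegrable (by fun_prop) _ _) fun s _ => ?_)
    rw [abs_mul]
    exact mul_le_of_le_one_right (abs_nonneg _) (abs_sin_le_one _)

theorem tendsto_integral_mul_cos {u : ℝ → ℝ} (hu : ContDiff ℝ 1 u) {c : ℝ} (hc : c ≠ 0) :
    Tendsto (fun t : ℝ => ∫ s in (0 : ℝ)..1, u s * cos (c * t * s)) atTop (nhds 0) := by
  obtain ⟨C, hC⟩ := abs_integral_mul_cos_le hu
  have hlim : Tendsto (fun t : ℝ => C / |c| / t) atTop (nhds 0) :=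
    tendsto_const_nhds.div_atTop tendsto_id
  refine squeeze_zero_norm' ?_ hlim
  filter_upwards [eventually_gt_atTop 0] with t ht
  have h := hC (c * t)
  rw [abs_mul, abs_mul, abs_of_pos ht] at h
  rw [norm_eq_abs, div_div, le_div_iff₀ (by positivity)]
  linarith

theorem countable_setOf_cos_add_sin_eq_zero : {θ : ℝ | cos θ + sin θ = 0}.Countable := by
  refine (Set.countable_range fun k : ℤ => (2 * k + 1) * π / 2 + π / 4).mono fun θ hθ => ?_
  have hθ : cos θ + sin θ = 0 := hθ
  have h : cos (θ - π / 4) = 0 := by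
    rw [cos_sub, cos_pi_div_four, sin_pi_div_four, ← add_mul, hθ, zero_mul]
  obtain ⟨k, hk⟩ := cos_eq_zero_iff.1 h
  exact ⟨k, by simp only; linarith⟩

/-- Dilating the frequency to infinity removes the oscillating term from the angular average. -/
theorem tendsto_integral_one_add_integral_mul_cos {u : ℝ → ℝ} (hu : ContDiff ℝ 1 u) :
    Tendsto (fun t : ℝ => ∫ θ in (-π)..π,
        (1 + ∫ s in (0 : ℝ)..1, u s * cos ((cos θ + sin θ) * t * s)))
      atTop (nhds (2 * π)) := by
  have huc : Continuous u := hu.continuous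
  have hval : ∫ _ in (-π)..π, (1 : ℝ) = 2 * π := by simp; ring
  rw [← hval]
  refine intervalIntegral.tendsto_integral_filter_of_dominated_convergence
    (fun _ => 1 + ∫ s in (0 : ℝ)..1, |u s|) ?_ ?_ intervalIntegrable_const ?_
  · refine Eventually.of_forall fun t => Continuous.aestronglyMeasurable ?_
    refine continuous_const.add
      (intervalIntegral.continuous_parametric_intervalIntegral_of_continuous' ?_ _ _)
    fun_prop
  · refine Eventually.of_forall fun t => Eventually.of_forall fun θ _ => ?_
    refine (norm_add_le _ _).trans (add_le_add (by simp) ?_)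
    refine (intervalIntegral.abs_integral_le_integral_abs zero_le_one).trans
      (intervalIntegral.integral_mono_on zero_le_one
        (Continuous.intervalIntegrable (by fun_prop) _ _)
        (Continuous.intervalIntegrable (by fun_prop) _ _) fun s _ => ?_)
    rw [abs_mul]
    exact mul_le_of_le_one_right (abs_nonneg _) (abs_cos_le_one _)
  · filter_upwards [countable_setOf_cos_add_sin_eq_zero.ae_notMem volume] with θ hθ _
    simpa using (tendsto_integral_mul_cos hu hθ).const_add 1

/-- Positivity of the limiting constant. -/
theorem limiting_constant_positive (g : ℝ → ℝ) (hg : IsCutoff g)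
    (ε : ℝ) (hε : ε ∈ Set.Ioo (0 : ℝ) 1) :
    ∃ L : ℝ, 0 < L ∧
      Tendsto (fun N : ℝ => ∫ h : ℝ × ℝ, (h.1 / (h.1 ^ 2 + h.2 ^ 2))
          * Real.sin (h.1 + h.2) * g (N ^ (ε - 1) * rad h)) atTop (nhds L) := by
  obtain ⟨hsmooth, -, hone, hzero⟩ := hg
  have hg1 : ContDiff ℝ 1 g := hsmooth.of_le (by exact_mod_cast le_top)
  have hdg : ContDiff ℝ 1 (deriv g) :=
    ContDiff.deriv' (hsmooth.of_le (WithTop.coe_le_coe.2 (le_top : (1 + 1 : ℕ∞) ≤ ⊤)))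
  have hgc : Continuous g := hg1.continuous
  refine ⟨π, pi_pos, ?_⟩
  have hlim := ((tendsto_integral_one_add_integral_mul_cos hdg).comp
    (tendsto_rpow_atTop (sub_pos.2 hε.2))).const_mul (1 / 2)
  rw [show 1 / 2 * (2 * π) = π by ring] at hlim
  refine hlim.congr' ?_
  filter_upwards [eventually_gt_atTop 0] with N hN
  have hd : 0 < N ^ (ε - 1) := rpow_pos_of_pos hN _
  have hinv : N ^ (1 - ε) = (N ^ (ε - 1))⁻¹ := by
    rw [← rpow_neg hN.le, neg_sub]
  have hΨ : Continuous fun c : ℝ =>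
      ∫ r in (0 : ℝ)..(N ^ (ε - 1))⁻¹, g (N ^ (ε - 1) * r) * sin (c * r) :=
    intervalIntegral.continuous_parametric_intervalIntegral_of_continuous' (by fun_prop) _ _
  rw [integral_cutoff_eq_polar hgc hzero hd, integral_cos_mul_comp_cos_add_sin hΨ]
  simp only [mul_integral_cutoff_mul_sin hg1 (hone 0 (by norm_num)) (hzero 1 le_rfl) hd,
    Function.comp_apply, hinv]
end

section
/- Regularized Frullani-type identity and positivity: for all real numbers 0 < K₁ ≤ K₂, the limit lim_{λ→0⁺} ∫₀^∞ ((cos(K₁ R) − cos(K₂ R))/R) g(λ R) dR exists and equals ∫₀^∞ R^{−1} (g(R/K₂) − g(R/K₁)) dR; moreover, if K₁ < K₂ then this common value is strictly positive. -/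
open MeasureTheory Real Filter

/-- Integrating by parts twice, the truncated sine transform of a `C²` function `g` with `g 1 = 0`
is `g 0 / k` up to an error that is linear in the truncation parameter. -/
lemma abs_integral_sin_mul_comp_sub_le {g : ℝ → ℝ} (hg : ContDiff ℝ 2 g) (h1 : g 1 = 0) {C : ℝ}
    (hC : ∀ x ∈ Set.Icc (0 : ℝ) 1, |deriv (deriv g) x| ≤ C) {k lam : ℝ} (hk : 0 < k)
    (hlam : 0 < lam) :
    |(∫ R in (0 : ℝ)..lam⁻¹, sin (k * R) * g (lam * R)) - g 0 / k| ≤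
      lam / k ^ 2 * (|deriv g 1| + C) := by
  have hg' : Differentiable ℝ g := hg.differentiable (by norm_num)
  have hg'' : Differentiable ℝ (deriv g) := hg.differentiable_deriv_two
  have hc'' : Continuous (deriv (deriv g)) :=
    (ContDiff.deriv' (n := 1) (by simpa [one_add_one_eq_two] using hg)).continuous_deriv_one
  have hc : Continuous g := hg.continuous
  have hderiv : ∀ R : ℝ, HasDerivAt
      (fun R => -cos (k * R) / k * g (lam * R) + lam / k ^ 2 * sin (k * R) * deriv g (lam * R))
      (sin (k * R) * g (lam * R) + lam ^ 2 / k ^ 2 * (sin (k * R) * deriv (deriv g) (lam * R)))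
      R := by
    intro R
    have hl : HasDerivAt (fun R : ℝ => lam * R) lam R := by
      simpa using (hasDerivAt_id R).const_mul lam
    have hkR : HasDerivAt (fun R : ℝ => k * R) k R := by
      simpa using (hasDerivAt_id R).const_mul k
    have e1 := (hg' (lam * R)).hasDerivAt.comp R hl
    have e2 := (hg'' (lam * R)).hasDerivAt.comp R hl
    convert! ((hkR.cos.neg.div_const k).mul e1).add ((hkR.sin.const_mul (lam / k ^ 2)).mul e2)
      using 1
    simp only [Function.comp, Pi.neg_apply]
    field_simp
    ring
  have hi1 : IntervalIntegrable (fun R => sin (k * R) * g (lam * R)) volume 0 lam⁻¹ :=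
    (by fun_prop : Continuous _).intervalIntegrable _ _
  have hi2 : IntervalIntegrable
      (fun R => lam ^ 2 / k ^ 2 * (sin (k * R) * deriv (deriv g) (lam * R))) volume 0 lam⁻¹ :=
    (by fun_prop : Continuous _).intervalIntegrable _ _
  have hftc := intervalIntegral.integral_eq_sub_of_hasDerivAt (fun R _ => hderiv R) (hi1.add hi2)
  rw [intervalIntegral.integral_add hi1 hi2, intervalIntegral.integral_const_mul] at hftc
  have hbound : |∫ R in (0 : ℝ)..lam⁻¹, sin (k * R) * deriv (deriv g) (lam * R)| ≤ C * lam⁻¹ := by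
    have h := intervalIntegral.norm_integral_le_of_norm_le_const (a := 0) (b := lam⁻¹) (C := C)
      (f := fun R => sin (k * R) * deriv (deriv g) (lam * R)) ?_
    · simpa [abs_of_pos hlam] using h
    · intro R hR
      rw [Set.uIoc_of_le (by positivity)] at hR
      have hmem : lam * R ∈ Set.Icc (0 : ℝ) 1 := by
        refine ⟨mul_nonneg hlam.le hR.1.le, ?_⟩
        calc lam * R ≤ lam * lam⁻¹ := by gcongr; exact hR.2
          _ = 1 := mul_inv_cancel₀ hlam.ne'
      rw [norm_mul, norm_eq_abs, norm_eq_abs]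
      calc |sin (k * R)| * |deriv (deriv g) (lam * R)| ≤ 1 * C := by
            gcongr
            · exact abs_sin_le_one _
            · exact hC _ hmem
        _ = C := one_mul C
  simp only [mul_inv_cancel₀ hlam.ne', h1, mul_zero, sin_zero, cos_zero, zero_mul, zero_add,
    add_zero] at hftc
  have heq : (∫ R in (0 : ℝ)..lam⁻¹, sin (k * R) * g (lam * R)) - g 0 / k =
      lam / k ^ 2 * (sin (k * lam⁻¹) * deriv g 1) - lam ^ 2 / k ^ 2 *
        ∫ R in (0 : ℝ)..lam⁻¹, sin (k * R) * deriv (deriv g) (lam * R) := by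
    linear_combination hftc
  have hsin : |sin (k * lam⁻¹) * deriv g 1| ≤ |deriv g 1| := by
    rw [abs_mul]
    exact mul_le_of_le_one_left (abs_nonneg _) (abs_sin_le_one _)
  rw [heq]
  refine (abs_sub _ _).trans ?_
  rw [abs_mul, abs_mul (lam ^ 2 / k ^ 2), abs_of_pos (by positivity : 0 < lam / k ^ 2),
    abs_of_pos (by positivity : 0 < lam ^ 2 / k ^ 2)]
  calc _ ≤ lam / k ^ 2 * |deriv g 1| + lam ^ 2 / k ^ 2 * (C * lam⁻¹) := by gcongr
    _ = _ := by field_simp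

/-- Fubini's theorem turns the cutoff Frullani integral of the cosine into an average of truncated
sine transforms. -/
lemma integral_cos_sub_cos_div_mul_comp {g : ℝ → ℝ} (hg : Continuous g)
    (h1 : ∀ r : ℝ, 1 ≤ r → g r = 0) (a b : ℝ) {lam : ℝ} (hlam : 0 < lam) :
    ∫ R in Set.Ioi (0 : ℝ), ((cos (a * R) - cos (b * R)) / R) * g (lam * R) =
      ∫ k in a..b, ∫ R in (0 : ℝ)..lam⁻¹, sin (k * R) * g (lam * R) := by
  have hcont : Continuous (Function.uncurry fun k R : ℝ => sin (k * R) * g (lam * R)) := by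
    unfold Function.uncurry
    fun_prop
  rw [intervalIntegral_intervalIntegral_swap
      ((hcont.continuousOn.integrableOn_compact (isCompact_uIcc.prod isCompact_uIcc)).mono_set
        (Set.prod_mono Set.uIoc_subset_uIcc Set.uIoc_subset_uIcc)),
    intervalIntegral.integral_of_le (by positivity),
    setIntegral_eq_of_subset_of_forall_sdiff_eq_zero (s := Set.Ioc 0 lam⁻¹) measurableSet_Ioi
      Set.Ioc_subset_Ioi_self]
  · refine setIntegral_congr_fun measurableSet_Ioc fun R hR => ?_
    have hR0 : R ≠ 0 := hR.1.ne'
    simp only [intervalIntegral.integral_mul_const]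
    rw [intervalIntegral.integral_comp_mul_right (fun x => sin x) hR0, integral_sin, smul_eq_mul]
    ring
  · rintro R ⟨hR0, hR⟩
    have hlt : lam⁻¹ < R := by
      by_contra! h
      exact hR ⟨hR0, h⟩
    rw [h1, mul_zero]
    calc 1 = lam * lam⁻¹ := (mul_inv_cancel₀ hlam.ne').symm
      _ ≤ lam * R := by gcongr

/-- The cutoff Frullani integral of the cosine converges to `log (b / a)`. -/
lemma tendsto_integral_cos_sub_cos_div_mul_comp {g : ℝ → ℝ} (hg : ContDiff ℝ 2 g) (h0 : g 0 = 1)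
    (h1 : ∀ r : ℝ, 1 ≤ r → g r = 0) {a b : ℝ} (ha : 0 < a) (hab : a ≤ b) :
    Tendsto (fun lam : ℝ =>
        ∫ R in Set.Ioi (0 : ℝ), ((cos (a * R) - cos (b * R)) / R) * g (lam * R))
      (nhdsWithin (0 : ℝ) (Set.Ioi 0)) (nhds (log (b / a))) := by
  have hc'' : Continuous (deriv (deriv g)) :=
    (ContDiff.deriv' (n := 1) (by simpa [one_add_one_eq_two] using hg)).continuous_deriv_one
  obtain ⟨C, hC⟩ := isCompact_Icc.exists_bound_of_continuousOn (s := Set.Icc (0 : ℝ) 1)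
    hc''.continuousOn
  have hC0 : 0 ≤ C := (norm_nonneg _).trans (hC 0 (by simp))
  have hcg : Continuous g := hg.continuous
  have hlim : Tendsto (fun lam : ℝ => lam / a ^ 2 * (|deriv g 1| + C) * |b - a|)
      (nhdsWithin (0 : ℝ) (Set.Ioi 0)) (nhds 0) := by
    have h : Continuous fun lam : ℝ => lam / a ^ 2 * (|deriv g 1| + C) * |b - a| := by fun_prop
    simpa using (h.tendsto 0).mono_left nhdsWithin_le_nhds
  rw [tendsto_iff_norm_sub_tendsto_zero]
  refine squeeze_zero' (Eventually.of_forall fun _ => norm_nonneg _) ?_ hlim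
  filter_upwards [self_mem_nhdsWithin] with lam hlam
  have hlam : 0 < lam := hlam
  have hinner : Continuous fun k : ℝ => ∫ R in (0 : ℝ)..lam⁻¹, sin (k * R) * g (lam * R) :=
    intervalIntegral.continuous_parametric_intervalIntegral_of_continuous' (by
      unfold Function.uncurry
      fun_prop) _ _
  have hinv : IntervalIntegrable (fun k : ℝ => 1 / k) volume a b := by
    refine ContinuousOn.intervalIntegrable fun k hk => ?_
    rw [Set.uIcc_of_le hab] at hk
    exact (continuousAt_const.div continuousAt_id (ha.trans_le hk.1).ne').continuousWithinAt
  rw [integral_cos_sub_cos_div_mul_comp hcg h1 a b hlam,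
    ← integral_one_div_of_pos ha (ha.trans_le hab),
    ← intervalIntegral.integral_sub (hinner.intervalIntegrable _ _) hinv]
  refine intervalIntegral.norm_integral_le_of_norm_le_const fun k hk => ?_
  rw [Set.uIoc_of_le hab] at hk
  have hk0 : 0 < k := ha.trans hk.1
  have hle := abs_integral_sin_mul_comp_sub_le hg (h1 1 le_rfl) hC hk0 hlam
  rw [h0] at hle
  refine hle.trans ?_
  gcongr
  exact hk.1.le

/-- The Frullani integral of a cutoff function. -/
lemma integral_cutoff_div_sub_cutoff_div {g : ℝ → ℝ} (hg : Continuous g)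
    (h0 : ∀ r : ℝ, r ≤ 1 / 2 → g r = 1) (h1 : ∀ r : ℝ, 1 ≤ r → g r = 0) {a b : ℝ} (ha : 0 < a)
    (hab : a ≤ b) :
    ∫ R in Set.Ioi (0 : ℝ), (g (R / b) - g (R / a)) / R = log (b / a) := by
  have hb : 0 < b := ha.trans_le hab
  have hint : IntegrableOn (fun x : ℝ => x⁻¹ • (g (b⁻¹ * x) - g (a⁻¹ * x))) (Set.Ioi 0) := by
    refine IntegrableOn.of_forall_sdiff_eq_zero (s := Set.Icc (a / 2) b) ?_ measurableSet_Ioi ?_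
    · refine ContinuousOn.integrableOn_compact isCompact_Icc fun x hx => ?_
      have hx0 : x ≠ 0 := ((half_pos ha).trans_le hx.1).ne'
      exact ((continuousAt_inv₀ hx0).smul
        (by fun_prop : Continuous fun x : ℝ => g (b⁻¹ * x) - g (a⁻¹ * x)).continuousAt
        ).continuousWithinAt
    · rintro x ⟨hx0, hx⟩
      have hx0 : 0 < x := hx0
      rcases lt_or_ge x (a / 2) with h | h
      · rw [h0, h0, sub_self, smul_zero]
        · rw [inv_mul_le_iff₀ ha]; linarith
        · rw [inv_mul_le_iff₀ hb]; linarith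
      · have hbx : b < x := by
          by_contra! h'
          exact hx ⟨h, h'⟩
        rw [h1, h1, sub_self, smul_zero]
        · rw [le_inv_mul_iff₀ ha]; linarith
        · rw [le_inv_mul_iff₀ hb]; linarith
  have h := Frullani.integral_Ioi_eq (L := 1) (R := 0)
    (hg.locallyIntegrable.locallyIntegrableOn _) (inv_pos.2 hb) (inv_pos.2 ha) ?_ ?_ hint
  · convert! h using 1
    · refine integral_congr_ae (Eventually.of_forall fun x => ?_)
      simp only [smul_eq_mul, div_eq_inv_mul]
    · rw [sub_zero, smul_eq_mul, mul_one, inv_div_inv]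
  · have h := (hg.tendsto 0).mono_left (nhdsWithin_le_nhds (s := Set.Ioi 0))
    rwa [h0 0 (by norm_num)] at h
  · exact tendsto_const_nhds.congr' ((eventually_ge_atTop 1).mono fun r hr => (h1 r hr).symm)

/-- Regularized Frullani-type identity and positivity. -/
theorem frullani_regularized (g : ℝ → ℝ) (hg : IsCutoff g)
    (K₁ K₂ : ℝ) (hK₁ : 0 < K₁) (hK : K₁ ≤ K₂) :
    Tendsto (fun lam : ℝ =>
        ∫ R in Set.Ioi (0 : ℝ), ((Real.cos (K₁ * R) - Real.cos (K₂ * R)) / R) * g (lam * R))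
      (nhdsWithin (0 : ℝ) (Set.Ioi 0))
      (nhds (∫ R in Set.Ioi (0 : ℝ), (g (R / K₂) - g (R / K₁)) / R)) ∧
    (K₁ < K₂ → 0 < ∫ R in Set.Ioi (0 : ℝ), (g (R / K₂) - g (R / K₁)) / R) := by
  obtain ⟨hsmooth, -, h0, h1⟩ := hg
  rw [integral_cutoff_div_sub_cutoff_div hsmooth.continuous h0 h1 hK₁ hK]
  exact ⟨tendsto_integral_cos_sub_cos_div_mul_comp (contDiff_infty.1 hsmooth 2)
    (h0 0 (by norm_num)) h1 hK₁ hK, fun h => log_pos ((one_lt_div hK₁).2 h)⟩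
end
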